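/- Let η_n := ∏_{k=1}^n ∏_{i=1}^d ω^{(k)}(ζ_i)^{q−1} ∈ K_n(ζ) (with η_0 := 1). Then the orbit of η_n under the group of field automorphisms of K_n(ζ) fixing K_0(ζ) pointwise is a basis of K_n(ζ) as a vector space over K_0(ζ); that is, the Galois conjugates of η_n form a normal basis for the extension K_n(ζ)/K_0(ζ). -/

import Mathlib

theorem HasSum.eq_zero_of_powerSeries {L : Type*} [NormedField L] {θ : L} (hθ : 1 < ‖θ‖)
    {a : ℕ → L} (h : ∀ z : L, ‖z‖ ≤ 1 → HasSum (fun i => a i * z ^ i) 0) (i : ℕ) : a i = 0 := by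
  let _ : NontriviallyNormedField L := { ‹NormedField L› with non_trivial := ⟨θ, hθ⟩ }
  have hp : HasFPowerSeriesAt (fun _ : L => (0 : L)) (FormalMultilinearSeries.ofScalars L a) 0 := by
    rw [hasFPowerSeriesAt_iff]
    filter_upwards [Metric.closedBall_mem_nhds (0 : L) one_pos] with z hz
    simpa [FormalMultilinearSeries.coeff_ofScalars, mul_comm] using h z (by simpa using hz)
  have := congrArg (fun P => FormalMultilinearSeries.coeff P i) hp.eq_zero
  rw [FormalMultilinearSeries.coeff_ofScalars] at this
  exact this.trans (by simp [FormalMultilinearSeries.coeff])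

theorem HasSum.of_eq {L : Type*} [NormedField L] {f g : ℕ → L} {a b : L} (h : HasSum f a)
    (hf : ∀ i, g i = f i) (hab : b = a) : HasSum g b := by
  rw [hab, funext hf]
  exact h

theorem HasSum.pow_char_pow {L : Type*} [NormedField L] {p κ q : ℕ} (hp : p.Prime) [CharP L p]
    (hq : q = p ^ κ) {f : ℕ → L} {a : L} (h : HasSum f a) :
    HasSum (fun i => f i ^ q) (a ^ q) := by
  have : Fact p.Prime := ⟨hp⟩
  subst hq
  have := h.map (iterateFrobenius L p κ)
    ((continuous_pow (M := L) (p ^ κ)).congr fun x => (iterateFrobenius_def p κ x).symm)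
  simpa only [Function.comp_def, iterateFrobenius_def] using this

theorem IsNonarchimedean.norm_one_sub_of_lt {L : Type*} [NormedField L]
    (hna : IsNonarchimedean (fun x : L => ‖x‖)) {x : L} (hx : ‖x‖ < 1) : ‖1 - x‖ = 1 := by
  have h1 := hna 1 (-x)
  have h2 := hna (1 - x) x
  simp only [← sub_eq_add_neg, norm_one, norm_neg, sub_add_cancel] at h1 h2
  rw [max_eq_left hx.le] at h1
  rcases le_max_iff.1 h2 with h | h
  · exact le_antisymm h1 h
  · exact absurd hx h.not_gt

section AndersonThakur

variable {L : Type*} [NormedField L] {p q κ : ℕ} {θ lamθ : L} {w : ℕ → L}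

theorem norm_one_sub_div_pow (hna : IsNonarchimedean (fun x : L => ‖x‖)) (hθ : 1 < ‖θ‖)
    (hq : 0 < q) {z : L} (hz : ‖z‖ ≤ 1) (j : ℕ) : ‖1 - z / θ ^ q ^ j‖ = 1 := by
  apply hna.norm_one_sub_of_lt
  have : 1 < ‖θ‖ ^ q ^ j := one_lt_pow₀ hθ (pow_pos hq j).ne'
  rw [norm_div, norm_pow, div_lt_one (by positivity)]
  exact hz.trans_lt this

theorem andersonThakur_product_ne_zero (hna : IsNonarchimedean (fun x : L => ‖x‖))
    (hθ : 1 < ‖θ‖) (hq : 0 < q) {z P : L} (hz : ‖z‖ ≤ 1)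
    (hP : HasProd (fun j : ℕ => (1 - z / θ ^ q ^ j)⁻¹) P) : P ≠ 0 := by
  have h := (continuous_norm.tendsto P).comp hP.tendsto_prod_nat
  have h1 : (norm ∘ fun n : ℕ => ∏ j ∈ Finset.range n, (1 - z / θ ^ q ^ j)⁻¹) = fun _ => 1 := by
    funext n
    simp [norm_prod, norm_one_sub_div_pow hna hθ hq hz]
  rw [h1] at h
  rw [← norm_ne_zero_iff, ← tendsto_nhds_unique tendsto_const_nhds h]
  exact one_ne_zero

theorem andersonThakur_product_pow (hna : IsNonarchimedean (fun x : L => ‖x‖)) (hp : p.Prime)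
    [CharP L p] (hq : q = p ^ κ) (hθ : 1 < ‖θ‖) {z P P' : L} (hz : ‖z‖ ≤ 1)
    (hP : HasProd (fun j : ℕ => (1 - z / θ ^ q ^ j)⁻¹) P)
    (hP' : HasProd (fun j : ℕ => (1 - z ^ q / θ ^ q ^ j)⁻¹) P') :
    P ^ q = (1 - z ^ q / θ) * P' := by
  have : Fact p.Prime := ⟨hp⟩
  have hq0 : 0 < q := hq ▸ pow_pos hp.pos κ
  have hzq : ‖z ^ q‖ ≤ 1 := by simpa using pow_le_one₀ (norm_nonneg z) hz
  have h : HasProd (fun j : ℕ => (1 - z ^ q / θ ^ q ^ (j + 1))⁻¹) (P ^ q) := by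
    have hfun : (fun j : ℕ => (1 - z ^ q / θ ^ q ^ (j + 1))⁻¹) =
        fun j : ℕ => (1 - z / θ ^ q ^ j)⁻¹ ^ q := by
      funext j
      rw [inv_pow]
      congr 1
      conv_rhs => rw [hq, sub_pow_char_pow, ← hq, one_pow, div_pow, ← pow_mul, ← pow_succ]
    rw [hfun]
    exact hP.pow q
  have h0 : (1 - z ^ q / θ) ≠ 0 := by
    have := norm_one_sub_div_pow hna hθ hq0 hzq 0
    intro h
    simp [h] at this
  have := hP'.unique (HasProd.zero_mul (f := fun j : ℕ => (1 - z ^ q / θ ^ q ^ j)⁻¹) h)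
  rw [this]
  simp [h0]

/-- The coefficients of the Anderson–Thakur function form a compatible system of
`θ`-power torsion points of the Carlitz module. -/
theorem andersonThakur_coeff_pow [IsAlgClosed L] (hna : IsNonarchimedean (fun x : L => ‖x‖))
    (hp : p.Prime) [CharP L p] (hq : q = p ^ κ) (hθ : 1 < ‖θ‖)
    (hlamθ : lamθ ^ (q - 1) = -θ)
    (hωdef : ∀ z : L, ‖z‖ ≤ 1 → ∃ P : L,
      HasProd (fun j : ℕ => (1 - z / θ ^ q ^ j)⁻¹) P ∧
      HasSum (fun i : ℕ => w i * z ^ i) (lamθ * P)) :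
    w 0 ^ q = -θ * w 0 ∧ ∀ i, w (i + 1) ^ q = w i - θ * w (i + 1) := by
  have hq0 : 0 < q := hq ▸ pow_pos hp.pos κ
  have hθ0 : θ ≠ 0 := norm_pos_iff.1 (one_pos.trans hθ)
  let w' : ℕ → L := fun i => Nat.casesOn i 0 w
  have key : ∀ y : L, ‖y‖ ≤ 1 → HasSum (fun i => (w i ^ q - (w' i - θ * w i)) * y ^ i) 0 := by
    intro y hy
    obtain ⟨z, rfl⟩ := IsAlgClosed.exists_pow_nat_eq y hq0
    have hz : ‖z‖ ≤ 1 := by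
      rwa [norm_pow, pow_le_one_iff_of_nonneg (norm_nonneg z) hq0.ne'] at hy
    obtain ⟨P, hP, hS⟩ := hωdef z hz
    obtain ⟨P', hP', hS'⟩ := hωdef _ hy
    have h1 := hS.pow_char_pow hp hq
    have h2 : HasSum (fun i => w' i * (z ^ q) ^ i) (z ^ q * (lamθ * P')) := by
      have : HasSum (fun i => w' (i + 1) * (z ^ q) ^ (i + 1)) (z ^ q * (lamθ * P')) :=
        (hS'.mul_left (z ^ q)).of_eq (fun i => by simp only [w']; ring) rfl
      exact (HasSum.zero_add (f := fun i => w' i * (z ^ q) ^ i) this).of_eq (fun _ => rfl)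
        (by simp [w'])
    have h3 := h1.sub (h2.sub (hS'.mul_left θ))
    refine h3.of_eq (fun i => ?_) ?_
    · rw [mul_pow, ← pow_mul, ← pow_mul]
      ring
    · rw [mul_pow, andersonThakur_product_pow hna hp hq hθ hz hP hP']
      have : lamθ ^ q = -θ * lamθ := by
        rw [← hlamθ, ← pow_succ, Nat.sub_add_cancel hq0]
      rw [this]
      field_simp
      ring
  have h := HasSum.eq_zero_of_powerSeries hθ key
  refine ⟨?_, fun i => ?_⟩
  · linear_combination (by simpa [w'] using h 0 : w 0 ^ q + θ * w 0 = 0)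
  · linear_combination h (i + 1)

theorem hyperderivative_pow_zero (hp : p.Prime) [CharP L p]
    (hq : q = p ^ κ) (h0 : w 0 ^ q = -θ * w 0) (hw : ∀ i, w (i + 1) ^ q = w i - θ * w (i + 1))
    {z a b : L}
    (ha : HasSum (fun i : ℕ => w i * z ^ i) a)
    (hb : HasSum (fun i : ℕ => w i * (z ^ q) ^ i) b) : a ^ q = (z ^ q - θ) * b := by
  have h1 := ha.pow_char_pow hp hq
  have h2 : HasSum (fun i => w (i + 1) ^ q * (z ^ q) ^ (i + 1))
      (z ^ q * b - θ * (b - w 0)) := by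
    have hb' : HasSum (fun i : ℕ => w (i + 1) * (z ^ q) ^ (i + 1)) (b - w 0) := by
      simpa using (hasSum_nat_add_iff' 1).2 hb
    have h := (hb.mul_left (z ^ q)).sub (hb'.mul_left θ)
    refine h.of_eq (fun i => ?_) rfl
    rw [hw]
    ring
  have h3 : HasSum (fun i => w i ^ q * (z ^ q) ^ i) ((z ^ q - θ) * b) := by
    refine (HasSum.zero_add (f := fun i => w i ^ q * (z ^ q) ^ i) h2).of_eq (fun _ => rfl) ?_
    rw [h0]
    ring
  refine h1.unique (h3.of_eq (fun i => ?_) rfl)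
  rw [mul_pow, ← pow_mul, ← pow_mul, mul_comm i]

theorem natCast_pow_char_pow (hp : p.Prime) [CharP L p] (hq : q = p ^ κ) (n : ℕ) :
    (n : L) ^ q = n := by
  have : Fact p.Prime := ⟨hp⟩
  rw [hq, ← iterateFrobenius_def, map_natCast]

theorem hyperderivative_pow_succ (hp : p.Prime) [CharP L p]
    (hq : q = p ^ κ) (hw : ∀ i, w (i + 1) ^ q = w i - θ * w (i + 1)) (m : ℕ) {z a b c : L}
    (ha : HasSum (fun i : ℕ => ((i + (m + 1)).choose (m + 1) : L) * w (i + (m + 1)) * z ^ i) a)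
    (hb : HasSum
      (fun i : ℕ => ((i + (m + 1)).choose (m + 1) : L) * w (i + (m + 1)) * (z ^ q) ^ i) b)
    (hc : HasSum (fun i : ℕ => ((i + m).choose m : L) * w (i + m) * (z ^ q) ^ i) c) :
    a ^ q = (z ^ q - θ) * b + c := by
  have h1 := ha.pow_char_pow hp hq
  have h2 : HasSum (fun i : ℕ => ((i + m).choose (m + 1) : L) * w (i + m) * (z ^ q) ^ i)
      (z ^ q * b) := by
    have : HasSum (fun i : ℕ => ((i + 1 + m).choose (m + 1) : L) * w (i + 1 + m) *
        (z ^ q) ^ (i + 1)) (z ^ q * b) := by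
      refine (hb.mul_left (z ^ q)).of_eq (fun i => ?_) rfl
      rw [show i + 1 + m = i + (m + 1) by ring]
      ring
    simpa using HasSum.zero_add
      (f := fun i : ℕ => ((i + m).choose (m + 1) : L) * w (i + m) * (z ^ q) ^ i) this
  have h3 := (h2.sub (hb.mul_left θ)).add hc
  rw [sub_mul]
  refine h1.unique (h3.of_eq (fun i => ?_) rfl)
  rw [mul_pow, mul_pow, natCast_pow_char_pow hp hq, ← add_assoc, hw, Nat.choose_succ_succ,
    ← pow_mul, ← pow_mul, mul_comm i]
  push_cast
  ring

end AndersonThakur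

/-- For a Galois group that is a `p`-group in characteristic `p`, an element of nonzero trace
has linearly independent conjugates. -/
theorem linearIndependent_conjugates_of_sum_ne_zero {E M : Type*} [Field E] [Field M]
    [Algebra E M] (p : ℕ) [Fact p.Prime] [CharP E p] [Fintype (M ≃ₐ[E] M)]
    (hG : IsPGroup p (M ≃ₐ[E] M)) (x : M) (hx : ∑ σ : M ≃ₐ[E] M, σ x ≠ 0) :
    LinearIndependent E (fun σ : M ≃ₐ[E] M => σ x) := by
  rw [Fintype.linearIndependent_iff]
  intro c hc
  by_contra! hne
  obtain ⟨σ₀, hσ₀⟩ := hne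
  let _ : Algebra (ZMod p) E := ZMod.algebra E p
  let _ : MulAction (M ≃ₐ[E] M) ((M ≃ₐ[E] M) → E) := arrowAction
  have smul_apply : ∀ (τ σ : M ≃ₐ[E] M) (g : (M ≃ₐ[E] M) → E), (τ • g) σ = g (τ⁻¹ * σ) :=
    fun _ _ _ => rfl
  let N : Submodule (ZMod p) ((M ≃ₐ[E] M) → E) :=
    Submodule.span (ZMod p) (Set.range fun τ : M ≃ₐ[E] M => τ • c)
  have hN_rel : ∀ g ∈ N, ∑ σ, g σ • σ x = 0 := by
    intro g hg
    induction hg using Submodule.span_induction with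
    | mem g hg =>
      obtain ⟨τ, rfl⟩ := hg
      have h := congrArg τ hc
      rw [map_zero, map_sum] at h
      rw [← h, ← Equiv.sum_comp (Equiv.mulLeft τ)]
      refine Finset.sum_congr rfl fun σ _ => ?_
      simp [smul_apply]
    | zero => simp
    | add g h _ _ hg hh => simp [add_smul, Finset.sum_add_distrib, hg, hh]
    | smul a g _ hg =>
      have : ∀ σ : M ≃ₐ[E] M, (a • g) σ • σ x = algebraMap (ZMod p) E a • (g σ • σ x) := by
        intro σ
        rw [Pi.smul_apply, Algebra.smul_def a (g σ), mul_smul]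
      simp only [this, ← Finset.smul_sum, hg, smul_zero]
  have hN_smul : ∀ (τ : M ≃ₐ[E] M) {g : (M ≃ₐ[E] M) → E}, g ∈ N → τ • g ∈ N := by
    intro τ g hg
    induction hg using Submodule.span_induction with
    | mem g hg =>
      obtain ⟨ρ, rfl⟩ := hg
      exact Submodule.subset_span ⟨τ * ρ, mul_smul _ _ _⟩
    | zero => exact N.zero_mem
    | add g h _ _ hg hh => exact N.add_mem hg hh
    | smul a g _ hg => exact N.smul_mem a hg
  let S : SubMulAction (M ≃ₐ[E] M) ((M ≃ₐ[E] M) → E) := ⟨N, fun τ _ hg => hN_smul τ hg⟩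
  have hfin : Module.Finite (ZMod p) N := Module.Finite.span_of_finite _ (Set.finite_range _)
  have hNfin : Finite N := Module.finite_of_finite (ZMod p)
  have hcN : c ∈ N := Submodule.subset_span ⟨1, one_smul _ c⟩
  have : Nontrivial N := ⟨⟨c, hcN⟩, 0, fun h => hσ₀ (congrFun (congrArg Subtype.val h) σ₀)⟩
  have hcard : p ∣ Nat.card S := by
    have h : Nat.card N = Nat.card (ZMod p) ^ Module.finrank (ZMod p) N :=
      Module.natCard_eq_pow_finrank
    rw [Nat.card_zmod] at h
    exact (dvd_pow_self p Module.finrank_pos.ne').trans (dvd_of_eq h.symm)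
  have : Finite S := hNfin
  have h0 : (⟨0, N.zero_mem⟩ : S) ∈ MulAction.fixedPoints (M ≃ₐ[E] M) S := fun τ => rfl
  obtain ⟨g, hg, hg0⟩ := hG.exists_fixed_point_of_prime_dvd_card_of_fixed_point S hcard h0
  have hconst : ∀ σ, g.1 σ = g.1 1 := fun σ => by
    have := congrFun (congrArg Subtype.val (hg σ)) σ
    rw [← this]
    change g.1 (σ⁻¹ * σ) = _
    rw [inv_mul_cancel]
  have hrel := hN_rel g.1 g.2
  simp only [hconst] at hrel
  rw [← Finset.smul_sum, smul_eq_zero] at hrel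
  refine hg0 (Subtype.ext (funext fun σ => ?_))
  rw [hconst]
  exact (hrel.resolve_right hx).symm

theorem Valuation.exists_zpow_eval {K Γ : Type*} [Field K] [LinearOrderedCommGroupWithZero Γ]
    (v : Valuation K Γ) (B : Subfield K) {t u : K} {N : ℕ} (hu : v u ^ N = v t)
    (hu0 : u ≠ 0) (hu1 : v u < 1) (hB : ∀ x ∈ B, x ≠ 0 → ∃ e : ℤ, v x = v t ^ e)
    {f : Polynomial K} (hf : ∀ i, f.coeff i ∈ B) (hdeg : f.natDegree < N) (hf0 : f ≠ 0) :
    ∃ e : ℤ, v (f.eval u) = v u ^ e := by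
  have hvu : v u ≠ 0 := (v.ne_zero_iff).2 hu0
  choose! e he using hB
  let E : ℕ → ℤ := fun i => N * e (f.coeff i) + i
  have hterm : ∀ i ∈ f.support, v (f.coeff i * u ^ i) = v u ^ E i := by
    intro i hi
    rw [map_mul, map_pow, he _ (hf i) (Polynomial.mem_support_iff.1 hi), ← hu]
    simp only [E]
    rw [zpow_add₀ hvu, zpow_mul, zpow_natCast, zpow_natCast]
  have hinj : ∀ i ∈ f.support, ∀ j ∈ f.support, E i = E j → i = j := by
    intro i hi j hj h
    have hi' := (Polynomial.le_natDegree_of_mem_supp i hi).trans_lt hdeg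
    have hj' := (Polynomial.le_natDegree_of_mem_supp j hj).trans_lt hdeg
    have := congrArg (· % (N : ℤ)) h
    simp only [E, Int.mul_add_emod_self_left] at this
    rw [Int.emod_eq_of_lt (by positivity) (by exact_mod_cast hi'),
      Int.emod_eq_of_lt (by positivity) (by exact_mod_cast hj')] at this
    exact_mod_cast this
  obtain ⟨m, hm, hmin⟩ := f.support.exists_min_image E (Polynomial.support_nonempty.2 hf0)
  refine ⟨E m, ?_⟩
  rw [Polynomial.eval_eq_sum, Polynomial.sum, ← Finset.add_sum_erase _ _ hm, ← hterm m hm]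
  refine v.map_add_eq_of_lt_left ?_
  refine v.map_sum_lt (by rw [hterm m hm]; exact zpow_ne_zero _ hvu) fun i hi => ?_
  have hi' := Finset.mem_of_mem_erase hi
  rw [hterm m hm, hterm i hi']
  refine zpow_lt_zpow_right_of_lt_one₀ (zero_lt_iff.2 hvu) hu1 ?_
  exact lt_of_le_of_ne (hmin i hi') fun h => (Finset.ne_of_mem_erase hi) (hinj _ hi' _ hm h.symm)

theorem sum_prod_add_pow_mul {k L : Type*} [Field k] [Fintype k] [Field L] (φ : k →+* L)
    {q d : ℕ} (hq : 1 < q) (hcard : Fintype.card k = q ^ d) (s t : ℕ → L) :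
    ∑ b : k, ∏ i ∈ Finset.range d, (s i + φ b ^ q ^ i * t i) ^ (q - 1) =
      -∏ i ∈ Finset.range d, t i ^ (q - 1) := by
  let F : ℕ → Polynomial L := fun i =>
    (Polynomial.C (s i) + Polynomial.X ^ q ^ i * Polynomial.C (t i)) ^ (q - 1)
  have hbase : ∀ i, (Polynomial.C (s i) + Polynomial.X ^ q ^ i * Polynomial.C (t i)).natDegree
      ≤ q ^ i := fun i => by compute_degree
  have hFdeg : ∀ i, (F i).natDegree ≤ (q - 1) * q ^ i := fun i =>
    Polynomial.natDegree_pow_le_of_le _ (hbase i)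
  have hFcoeff : ∀ i, (F i).coeff ((q - 1) * q ^ i) = t i ^ (q - 1) := fun i => by
    rw [Polynomial.coeff_pow_of_natDegree_le (hbase i)]
    have : q ^ i ≠ 0 := (pow_pos (by omega) i).ne'
    simp only [Polynomial.coeff_add, Polynomial.coeff_C, if_neg this, zero_add,
      Polynomial.coeff_mul_C, Polynomial.coeff_X_pow, if_true, one_mul]
  have hexp : ∀ e : ℕ, q ^ (e + 1) - 1 = (q ^ e - 1) + (q - 1) * q ^ e := fun e => by
    have h1 : 1 ≤ q ^ e := Nat.one_le_pow _ _ (by omega)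
    obtain ⟨r, rfl⟩ : ∃ r, q = r + 1 := ⟨q - 1, by omega⟩
    rw [pow_succ, Nat.add_sub_cancel, mul_add, mul_one, mul_comm]
    omega
  have hprod : ∀ e : ℕ, (∏ i ∈ Finset.range e, F i).natDegree ≤ q ^ e - 1 ∧
      (∏ i ∈ Finset.range e, F i).coeff (q ^ e - 1) = ∏ i ∈ Finset.range e, t i ^ (q - 1) := by
    intro e
    induction e with
    | zero => simp
    | succ e ih =>
      rw [Finset.prod_range_succ, Finset.prod_range_succ, hexp]
      exact ⟨Polynomial.natDegree_mul_le_of_le ih.1 (hFdeg e), by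
        rw [Polynomial.coeff_mul_add_eq_of_natDegree_le ih.1 (hFdeg e), ih.2, hFcoeff]⟩
  obtain ⟨hdeg, hcoeff⟩ := hprod d
  rw [← hcoeff]
  set H := ∏ i ∈ Finset.range d, F i
  have heval : ∀ b : k, ∏ i ∈ Finset.range d, (s i + φ b ^ q ^ i * t i) ^ (q - 1) =
      H.eval (φ b) := fun b => by
    rw [Polynomial.eval_prod]
    exact Finset.prod_congr rfl fun i _ => by
      simp only [F, Polynomial.eval_pow, Polynomial.eval_add, Polynomial.eval_C,
        Polynomial.eval_mul, Polynomial.eval_X]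
  simp_rw [heval, Polynomial.eval_eq_sum_range' (Nat.lt_succ_of_le hdeg)]
  rw [Finset.sum_comm, Finset.sum_range_succ, Finset.sum_eq_zero, zero_add]
  · rw [← Finset.mul_sum]
    have h1 : ∑ b : k, b ^ (q ^ d - 1) = -1 := by
      classical
      have hpos : q ^ d - 1 ≠ 0 := by
        have := Fintype.one_lt_card (α := k)
        omega
      have : ∀ b : k, b ^ (q ^ d - 1) = 1 - if b = 0 then 1 else 0 := fun b => by
        split_ifs with hb
        · simp [hb, hpos]
        · rw [← hcard, FiniteField.pow_card_sub_one_eq_one b hb, sub_zero]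
      simp [this]
    simp_rw [← map_pow, ← map_sum, h1]
    simp
  · intro j hj
    rw [← Finset.mul_sum]
    simp_rw [← map_pow, ← map_sum]
    rw [FiniteField.sum_pow_lt_card_sub_one k j (by rw [hcard]; exact Finset.mem_range.1 hj)]
    simp

theorem sum_prod_prod_add_pow_mul {k L : Type*} [Field k] [Fintype k] [Field L] (φ : k →+* L)
    {q d : ℕ} (hq : 1 < q) (hcard : Fintype.card k = q ^ d) (V : ℕ → ℕ → L) (n : ℕ) :
    ∑ a : Fin n → k, ∏ m ∈ Finset.range n, ∏ i ∈ Finset.range d,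
      (V (m + 1) i + ∑ j : Fin n, if (j : ℕ) ≤ m then φ (a j) ^ q ^ i * V (m - j) i else 0)
        ^ (q - 1) = (-∏ i ∈ Finset.range d, V 0 i ^ (q - 1)) ^ n := by
  induction n with
  | zero => simp
  | succ n ih =>
    rw [← (Fin.snocEquiv fun _ : Fin (n + 1) => k).sum_comp, Fintype.sum_prod_type, Finset.sum_comm,
      pow_succ, ← ih, Finset.sum_mul]
    refine Finset.sum_congr rfl fun a _ => ?_
    rw [← sum_prod_add_pow_mul φ hq hcard (fun i => V (n + 1) i + ∑ j : Fin n,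
      φ (a j) ^ q ^ i * V (n - j) i), Finset.mul_sum]
    refine Finset.sum_congr rfl fun b _ => ?_
    rw [Finset.prod_range_succ]
    congr 1
    · refine Finset.prod_congr rfl fun m hm => Finset.prod_congr rfl fun i _ => ?_
      have hm' : ¬ n ≤ m := by simpa using hm
      simp [Fin.snocEquiv, Fin.sum_univ_castSucc, hm']
    · refine Finset.prod_congr rfl fun i _ => ?_
      have (j : Fin n) : (j : ℕ) ≤ n := j.2.le
      simp [Fin.snocEquiv, Fin.sum_univ_castSucc, this, add_assoc]

/-- The relations satisfied by the Taylor coefficients `V m i` of order `m` of the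
Anderson–Thakur function at the conjugates `ζ ^ q ^ i` of `ζ`. -/
structure IsCarlitzTaylorSystem {k L : Type*} [Field k] [Field L] [Algebra k L] (q d : ℕ) (ζ : k)
    (θ : L) (V : ℕ → ℕ → L) : Prop where
  frobenius : ∃ Fr : L →+* L, ∀ x, Fr x = x ^ q
  ne_zero : V 0 0 ≠ 0
  periodic : ∀ m i, V m (i + d) = V m i
  zero_pow : ∀ i, V 0 i ^ q = (algebraMap k L ζ ^ q ^ (i + 1) - θ) * V 0 (i + 1)
  succ_pow : ∀ m i, V (m + 1) i ^ q =
    (algebraMap k L ζ ^ q ^ (i + 1) - θ) * V (m + 1) (i + 1) + V m (i + 1)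

/-- The twisted trace sum attached to a polynomial, whose values are the torsion points of
the Carlitz module. -/
noncomputable def twistedTrace {k L : Type*} [Field k] [Field L] [Algebra k L] (q d : ℕ)
    (V : ℕ → ℕ → L) (f : Polynomial k) : L :=
  f.sum fun m α => ∑ i ∈ Finset.range d, algebraMap k L α ^ q ^ i * V m i

/-- Division by the variable followed by adding a scalar multiple; the Carlitz action of
the variable corresponds to it under `twistedTrace`. -/
noncomputable def shiftEnd {k : Type*} [Field k] (ζ : k) : Module.End k (Polynomial k) where
  toFun f := Polynomial.C ζ * f + f.divX
  map_add' f g := by rw [Polynomial.divX_add]; ring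
  map_smul' c f := by
    simp only [Polynomial.smul_eq_C_mul, Polynomial.divX_C_mul, RingHom.id_apply]
    ring

theorem shiftEnd_apply {k : Type*} [Field k] (ζ : k) (f : Polynomial k) :
    shiftEnd ζ f = Polynomial.C ζ * f + f.divX := rfl

theorem aeval_shiftEnd_X_sub_C {k : Type*} [Field k] (ζ : k) (f : Polynomial k) :
    Polynomial.aeval (shiftEnd ζ) (Polynomial.X - Polynomial.C ζ) f = f.divX := by
  simp [shiftEnd_apply, Polynomial.smul_eq_C_mul]

theorem aeval_shiftEnd_C {k : Type*} [Field k] (ζ β : k) (h : Polynomial k) :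
    Polynomial.aeval (shiftEnd ζ) h (Polynomial.C β) = Polynomial.C (h.eval ζ * β) := by
  induction h using Polynomial.induction_on' with
  | add f g hf hg => simp [hf, hg, add_mul]
  | monomial m c =>
    have : ∀ m : ℕ, (shiftEnd ζ ^ m) (Polynomial.C β) = Polynomial.C (ζ ^ m * β) := by
      intro m
      induction m with
      | zero => simp
      | succ m ih =>
        rw [pow_succ', Module.End.mul_apply, ih, shiftEnd_apply, Polynomial.divX_C, add_zero,
          ← Polynomial.C_mul]
        ring_nf
    simp [this, Polynomial.aeval_monomial, Polynomial.smul_eq_C_mul, mul_assoc]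

theorem coeff_iterate_divX {k : Type*} [Field k] (f : Polynomial k) (m j : ℕ) :
    (Polynomial.divX^[m] f).coeff j = f.coeff (j + m) := by
  induction m generalizing j with
  | zero => simp
  | succ m ih => rw [Function.iterate_succ_apply', Polynomial.coeff_divX, ih, add_assoc, add_comm 1]

theorem aeval_shiftEnd_pow {k : Type*} [Field k] (ζ : k) {P h : Polynomial k}
    (hP : P = (Polynomial.X - Polynomial.C ζ) * h) (m : ℕ) (f : Polynomial k) :
    Polynomial.aeval (shiftEnd ζ) (P ^ m) f =
      Polynomial.aeval (shiftEnd ζ) (h ^ m) (Polynomial.divX^[m] f) := by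
  have key : ∀ f : Polynomial k,
      Polynomial.aeval (shiftEnd ζ) ((Polynomial.X - Polynomial.C ζ) ^ m) f =
        Polynomial.divX^[m] f := by
    induction m with
    | zero => simp
    | succ m ih =>
      intro f
      rw [pow_succ, map_mul, Module.End.mul_apply, aeval_shiftEnd_X_sub_C, ih,
        Function.iterate_succ_apply]
  rw [hP, mul_pow, mul_comm, map_mul, Module.End.mul_apply, key]

section TwistedTrace

variable {k L : Type*} [Field k] [Field L] [Algebra k L] {q d : ℕ} {ζ : k} {θ : L}
  {V : ℕ → ℕ → L}

theorem pow_pow_ringHom {Fr : L →+* L} (hFr : ∀ x, Fr x = x ^ q) (i : ℕ) (x : L) :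
    (Fr ^ i) x = x ^ q ^ i := by
  induction i with
  | zero => simp
  | succ i ih => rw [pow_succ', RingHom.mul_def, RingHom.comp_apply, ih, hFr, ← pow_mul, pow_succ]

theorem twistedTrace_monomial (hq : 0 < q) (m : ℕ) (α : k) :
    twistedTrace q d V (Polynomial.monomial m α) =
      ∑ i ∈ Finset.range d, algebraMap k L α ^ q ^ i * V m i := by
  rw [twistedTrace, Polynomial.sum_monomial_index]
  exact Finset.sum_eq_zero fun i _ => by rw [map_zero, zero_pow (pow_pos hq _).ne', zero_mul]

theorem twistedTrace_add (hq : 0 < q) (hV : IsCarlitzTaylorSystem q d ζ θ V) (f g : Polynomial k) :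
    twistedTrace q d V (f + g) = twistedTrace q d V f + twistedTrace q d V g := by
  obtain ⟨Fr, hFr⟩ := hV.frobenius
  refine Polynomial.sum_add_index _ _ _ (fun m => Finset.sum_eq_zero fun i _ => by
    rw [map_zero, zero_pow (pow_pos hq _).ne', zero_mul]) fun m a b => ?_
  rw [← Finset.sum_add_distrib]
  refine Finset.sum_congr rfl fun i _ => ?_
  rw [← pow_pow_ringHom hFr, ← pow_pow_ringHom hFr, ← pow_pow_ringHom hFr, map_add, map_add,
    add_mul]

theorem twistedTrace_shiftEnd [Fintype k] (hq : 0 < q) (hcard : Fintype.card k = q ^ d)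
    (hV : IsCarlitzTaylorSystem q d ζ θ V) (f : Polynomial k) :
    twistedTrace q d V (shiftEnd ζ f) = twistedTrace q d V f ^ q + θ * twistedTrace q d V f := by
  obtain ⟨Fr, hFr⟩ := hV.frobenius
  induction f using Polynomial.induction_on' with
  | add f g hf hg =>
    rw [map_add, twistedTrace_add hq hV, twistedTrace_add hq hV, hf, hg, ← hFr, ← hFr, ← hFr,
      map_add]
    ring
  | monomial m α =>
    have cyc : ∀ g : ℕ → L, g d = g 0 →
        ∑ i ∈ Finset.range d, g (i + 1) = ∑ i ∈ Finset.range d, g i := by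
      intro g hg
      have := Finset.sum_range_succ g d
      rw [Finset.sum_range_succ', hg] at this
      exact add_right_cancel this
    have hk : ∀ β : k, algebraMap k L β ^ q ^ d = algebraMap k L β := fun β => by
      rw [← map_pow, ← hcard, FiniteField.pow_card]
    have hVd : ∀ m, V m d = V m 0 := fun m => by simpa using hV.periodic m 0
    have hpow : twistedTrace q d V (Polynomial.monomial m α) ^ q =
        ∑ i ∈ Finset.range d, algebraMap k L α ^ q ^ (i + 1) * V m i ^ q := by
      rw [twistedTrace_monomial hq, ← hFr, map_sum]
      exact Finset.sum_congr rfl fun i _ => by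
        rw [map_mul, hFr, hFr, ← pow_mul, ← pow_succ]
    rw [hpow, shiftEnd_apply, Polynomial.C_mul_monomial, twistedTrace_add hq hV,
      twistedTrace_monomial hq, twistedTrace_monomial hq]
    cases m with
    | zero =>
      rw [Polynomial.monomial_zero_left, Polynomial.divX_C, ← Polynomial.monomial_zero_right 0,
        twistedTrace_monomial hq]
      simp only [hV.zero_pow]
      rw [cyc fun i => algebraMap k L α ^ q ^ i * ((algebraMap k L ζ ^ q ^ i - θ) * V 0 i),
        Finset.mul_sum, ← Finset.sum_add_distrib, ← Finset.sum_add_distrib]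
      · refine Finset.sum_congr rfl fun i _ => ?_
        rw [map_mul, mul_pow, map_zero, zero_pow (pow_pos hq _).ne']
        ring
      · simp only [hk, hVd, pow_zero, pow_one]
    | succ m =>
      have : (Polynomial.monomial (m + 1) α).divX = Polynomial.monomial m α := by
        ext j
        rw [Polynomial.coeff_divX, Polynomial.coeff_monomial, Polynomial.coeff_monomial]
        simp
      rw [this, twistedTrace_monomial hq]
      simp only [hV.succ_pow]
      rw [cyc fun i => algebraMap k L α ^ q ^ i *
          ((algebraMap k L ζ ^ q ^ i - θ) * V (m + 1) i + V m i),
        Finset.mul_sum, ← Finset.sum_add_distrib, ← Finset.sum_add_distrib]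
      · refine Finset.sum_congr rfl fun i _ => ?_
        rw [map_mul, mul_pow]
        ring
      · simp only [hk, hVd, pow_zero, pow_one]

end TwistedTrace

/-- The axioms for the Carlitz action `𝔠` of `𝔽[X]`. -/
structure IsCarlitzAction {𝔽 L : Type*} [Field 𝔽] [Field L] [Algebra 𝔽 L] (q : ℕ) (θ : L)
    (𝔠 : Polynomial 𝔽 → L → L) : Prop where
  add : ∀ a b x, 𝔠 (a + b) x = 𝔠 a x + 𝔠 b x
  mul : ∀ a b x, 𝔠 (a * b) x = 𝔠 a (𝔠 b x)
  const : ∀ s x, 𝔠 (Polynomial.C s) x = algebraMap 𝔽 L s * x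
  var : ∀ x, 𝔠 Polynomial.X x = x ^ q + θ * x

/-- The polynomials representing the iterates of `x ↦ x ^ q + θ * x`. -/
noncomputable def carlitzIterate {R : Type*} [CommRing R] (q : ℕ) (θ : R) : ℕ → Polynomial R
  | 0 => Polynomial.X
  | i + 1 => carlitzIterate q θ i ^ q + Polynomial.C θ * carlitzIterate q θ i

/-- The polynomial representing the Carlitz action of `a`. -/
noncomputable def carlitzPolynomial {𝔽 R : Type*} [Field 𝔽] [CommRing R] [Algebra 𝔽 R] (q : ℕ)
    (θ : R) (a : Polynomial 𝔽) : Polynomial R :=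
  ∑ i ∈ Finset.range (a.natDegree + 1),
    Polynomial.C (algebraMap 𝔽 R (a.coeff i)) * carlitzIterate q θ i

theorem carlitzIterate_monic {R : Type*} [Field R] {q : ℕ} (hq : 1 < q) (θ : R) (i : ℕ) :
    (carlitzIterate q θ i).Monic ∧ (carlitzIterate q θ i).natDegree = q ^ i := by
  induction i with
  | zero => simp [carlitzIterate, Polynomial.monic_X]
  | succ i ih =>
    have hpos : 0 < q ^ i := pow_pos (by omega) i
    have hdeg : (carlitzIterate q θ i ^ q).natDegree = q ^ (i + 1) := by
      rw [ih.1.natDegree_pow, ih.2, pow_succ']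
    have hlt : (Polynomial.C θ * carlitzIterate q θ i).natDegree <
        (carlitzIterate q θ i ^ q).natDegree := by
      refine (Polynomial.natDegree_C_mul_le _ _).trans_lt ?_
      rw [hdeg, ih.2]
      exact Nat.pow_lt_pow_right hq (Nat.lt_succ_self i)
    exact ⟨(ih.1.pow q).add_of_left (Polynomial.degree_lt_degree hlt), by
      rw [carlitzIterate, Polynomial.natDegree_add_eq_left_of_natDegree_lt hlt, hdeg]⟩

theorem carlitzPolynomial_monic {𝔽 R : Type*} [Field 𝔽] [Field R] [Algebra 𝔽 R] {q : ℕ}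
    (hq : 1 < q) (θ : R) {a : Polynomial 𝔽} (ha : a.Monic) :
    (carlitzPolynomial q θ a).Monic ∧
      (carlitzPolynomial q θ a).natDegree = q ^ a.natDegree := by
  have hZ := carlitzIterate_monic hq θ
  have hlt : (∑ i ∈ Finset.range a.natDegree,
      Polynomial.C (algebraMap 𝔽 R (a.coeff i)) * carlitzIterate q θ i).degree <
      (carlitzIterate q θ a.natDegree).degree := by
    rw [Polynomial.degree_eq_natDegree (hZ _).1.ne_zero, (hZ _).2]
    refine (Polynomial.degree_sum_le _ _).trans_lt ?_
    rw [Finset.sup_lt_iff (WithBot.bot_lt_coe _)]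
    intro i hi
    refine Polynomial.degree_le_natDegree.trans_lt ?_
    refine Nat.cast_lt.2 ((Polynomial.natDegree_C_mul_le _ _).trans_lt ?_)
    rw [(hZ _).2]
    exact Nat.pow_lt_pow_right hq (Finset.mem_range.1 hi)
  have heq : carlitzPolynomial q θ a = carlitzIterate q θ a.natDegree +
      ∑ i ∈ Finset.range a.natDegree,
        Polynomial.C (algebraMap 𝔽 R (a.coeff i)) * carlitzIterate q θ i := by
    rw [carlitzPolynomial, Finset.sum_range_succ, ha.coeff_natDegree, map_one, map_one, one_mul,
      add_comm]
  rw [heq]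
  exact ⟨(hZ _).1.add_of_left hlt, by
    rw [Polynomial.natDegree_add_eq_left_of_degree_lt hlt, (hZ _).2]⟩

theorem carlitzPolynomial_map {𝔽 R S : Type*} [Field 𝔽] [CommRing R] [CommRing S] [Algebra 𝔽 R]
    [Algebra 𝔽 S] (φ : R →ₐ[𝔽] S) (q : ℕ) (θ : R) (a : Polynomial 𝔽) :
    (carlitzPolynomial q θ a).map (φ : R →+* S) = carlitzPolynomial q (φ θ) a := by
  have hZ : ∀ i, (carlitzIterate q θ i).map (φ : R →+* S) = carlitzIterate q (φ θ) i := by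
    intro i
    induction i with
    | zero => simp [carlitzIterate]
    | succ i ih => simp [carlitzIterate, ih]
  simp [carlitzPolynomial, Polynomial.map_sum, hZ]

theorem IsCarlitzAction.eq_eval {𝔽 L : Type*} [Field 𝔽] [Field L] [Algebra 𝔽 L] {q : ℕ} {θ : L}
    {𝔠 : Polynomial 𝔽 → L → L} (h𝔠 : IsCarlitzAction q θ 𝔠) (a : Polynomial 𝔽) (x : L) :
    𝔠 a x = (carlitzPolynomial q θ a).eval x := by
  have hZ : ∀ i, 𝔠 (Polynomial.X ^ i) x = (carlitzIterate q θ i).eval x := by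
    intro i
    induction i with
    | zero => simpa [carlitzIterate] using h𝔠.const 1 x
    | succ i ih => rw [pow_succ', h𝔠.mul, ih, h𝔠.var]; simp [carlitzIterate]
  have h0 : 𝔠 0 x = 0 := by simpa using h𝔠.const 0 x
  let φ : Polynomial 𝔽 →+ L := ⟨⟨fun a => 𝔠 a x, h0⟩, fun a b => h𝔠.add a b x⟩
  change φ a = _
  conv_lhs => rw [a.as_sum_range_C_mul_X_pow]
  rw [map_sum, carlitzPolynomial, Polynomial.eval_finsetSum]
  refine Finset.sum_congr rfl fun i _ => ?_
  change 𝔠 _ x = _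
  rw [h𝔠.mul, h𝔠.const, hZ, Polynomial.eval_mul, Polynomial.eval_C]

section Torsion

variable {k L : Type*} [Field k] [Field L] [Algebra k L] {q d : ℕ} {ζ : k} {θ : L} {V : ℕ → ℕ → L}

theorem twistedTrace_C_mul (hq : 0 < q) (hV : IsCarlitzTaylorSystem q d ζ θ V) {s : k}
    (hs : s ^ q = s) (f : Polynomial k) :
    twistedTrace q d V (Polynomial.C s * f) = algebraMap k L s * twistedTrace q d V f := by
  have hs' : ∀ i, algebraMap k L s ^ q ^ i = algebraMap k L s := by
    intro i
    induction i with
    | zero => simp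
    | succ i ih => rw [pow_succ, pow_mul, ih, ← map_pow, hs]
  induction f using Polynomial.induction_on' with
  | add f g hf hg => rw [mul_add, twistedTrace_add hq hV, twistedTrace_add hq hV, hf, hg, mul_add]
  | monomial m α =>
    rw [Polynomial.C_mul_monomial, twistedTrace_monomial hq, twistedTrace_monomial hq,
      Finset.mul_sum]
    refine Finset.sum_congr rfl fun i _ => ?_
    rw [map_mul, mul_pow, hs', mul_assoc]

theorem twistedTrace_zero (q d : ℕ) (V : ℕ → ℕ → L) : twistedTrace q d V (0 : Polynomial k) = 0 :=
  Polynomial.sum_zero_index _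

/-- A Lagrange-type inversion recovering `V m 0` from values of the twisted trace. -/
theorem algebraMap_eval_mul_eq_sum_twistedTrace (hq : 0 < q) (hd : 0 < d) {h : Polynomial k}
    (hh : ∀ i, 0 < i → i < d → h.eval (ζ ^ q ^ i) = 0) (m : ℕ) :
    algebraMap k L (h.eval ζ) * V m 0 = ∑ j ∈ Finset.range (h.natDegree + 1),
      algebraMap k L (h.coeff j) * twistedTrace q d V (Polynomial.monomial m (ζ ^ j)) := by
  simp_rw [twistedTrace_monomial hq, Finset.mul_sum]
  rw [Finset.sum_comm]
  have : ∀ i, ∑ j ∈ Finset.range (h.natDegree + 1),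
      algebraMap k L (h.coeff j) * (algebraMap k L (ζ ^ j) ^ q ^ i * V m i) =
        algebraMap k L (h.eval (ζ ^ q ^ i)) * V m i := by
    intro i
    rw [Polynomial.eval_eq_sum_range, map_sum, Finset.sum_mul]
    refine Finset.sum_congr rfl fun j _ => ?_
    rw [← map_pow, ← mul_assoc, ← map_mul, ← pow_mul, ← pow_mul, mul_comm j]
  simp_rw [this]
  rw [Finset.sum_eq_single_of_mem 0 (Finset.mem_range.2 hd)]
  · simp
  · intro i hi hi0
    rw [hh i (Nat.pos_of_ne_zero hi0) (Finset.mem_range.1 hi), map_zero, zero_mul]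

variable {𝔽 : Type*} [Field 𝔽] [Fintype 𝔽] [Fintype k] [Algebra 𝔽 k] [Algebra 𝔽 L]
  [IsScalarTower 𝔽 k L]
  {𝔠 : Polynomial 𝔽 → L → L}

theorem IsCarlitzAction.apply_twistedTrace (h𝔠 : IsCarlitzAction q θ 𝔠) (hq : 0 < q)
    (hcard𝔽 : Fintype.card 𝔽 = q) (hcard : Fintype.card k = q ^ d)
    (hV : IsCarlitzTaylorSystem q d ζ θ V) (a : Polynomial 𝔽) (f : Polynomial k) :
    𝔠 a (twistedTrace q d V f) =
      twistedTrace q d V (Polynomial.aeval (shiftEnd ζ) (a.map (algebraMap 𝔽 k)) f) := by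
  induction a using Polynomial.induction_on generalizing f with
  | C s =>
    rw [h𝔠.const, Polynomial.map_C, Polynomial.aeval_C, Module.algebraMap_end_apply,
      Polynomial.smul_eq_C_mul, twistedTrace_C_mul hq hV, ← IsScalarTower.algebraMap_apply]
    rw [← map_pow, ← hcard𝔽, FiniteField.pow_card]
  | add a b ha hb =>
    rw [h𝔠.add, ha, hb, Polynomial.map_add, map_add, LinearMap.add_apply, twistedTrace_add hq hV]
  | monomial n s ih =>
    rw [pow_succ, ← mul_assoc, h𝔠.mul, h𝔠.var, ← twistedTrace_shiftEnd hq hcard hV, ih,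
      Polynomial.map_mul, map_mul _ (Polynomial.map _ _), Module.End.mul_apply]
    simp

theorem IsCarlitzAction.apply_twistedTrace_eq_zero (h𝔠 : IsCarlitzAction q θ 𝔠) (hq : 0 < q)
    (hcard𝔽 : Fintype.card 𝔽 = q) (hcard : Fintype.card k = q ^ d)
    (hV : IsCarlitzTaylorSystem q d ζ θ V) {𝔭 : Polynomial 𝔽} {h : Polynomial k}
    (h𝔭 : 𝔭.map (algebraMap 𝔽 k) = (Polynomial.X - Polynomial.C ζ) * h) {n : ℕ}
    {f : Polynomial k} (hf : f.degree < n) : 𝔠 (𝔭 ^ n) (twistedTrace q d V f) = 0 := by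
  rw [h𝔠.apply_twistedTrace hq hcard𝔽 hcard hV, Polynomial.map_pow, aeval_shiftEnd_pow ζ h𝔭]
  have : Polynomial.divX^[n] f = 0 := by
    ext j
    rw [coeff_iterate_divX, Polynomial.coeff_zero, Polynomial.coeff_eq_zero_of_degree_lt]
    exact hf.trans_le (by exact_mod_cast Nat.le_add_left n j)
  rw [this, map_zero, twistedTrace_zero]

theorem IsCarlitzAction.twistedTrace_ne_zero (h𝔠 : IsCarlitzAction q θ 𝔠) (hq : 0 < q)
    (hd : 0 < d) (hcard𝔽 : Fintype.card 𝔽 = q) (hcard : Fintype.card k = q ^ d)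
    (hV : IsCarlitzTaylorSystem q d ζ θ V) {𝔭 : Polynomial 𝔽} {h : Polynomial k}
    (h𝔭 : 𝔭.map (algebraMap 𝔽 k) = (Polynomial.X - Polynomial.C ζ) * h) (hζ : h.eval ζ ≠ 0)
    (hh : ∀ i, 0 < i → i < d → h.eval (ζ ^ q ^ i) = 0)
    (hsurj : ∀ α : k, ∃ a : Polynomial 𝔽, Polynomial.aeval ζ a = α)
    {f : Polynomial k} (hf : f ≠ 0) : twistedTrace q d V f ≠ 0 := by
  intro hTf
  have h0 : ∀ a, 𝔠 a 0 = 0 := fun a => by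
    rw [← twistedTrace_zero (k := k) q d V, h𝔠.apply_twistedTrace hq hcard𝔽 hcard hV, map_zero,
      twistedTrace_zero]
  have hdiv : Polynomial.divX^[f.natDegree] f = Polynomial.C f.leadingCoeff := by
    ext j
    rw [coeff_iterate_divX, Polynomial.coeff_C]
    split_ifs with hj
    · rw [hj, zero_add, Polynomial.coeff_natDegree]
    · exact Polynomial.coeff_eq_zero_of_natDegree_lt (by omega)
  have h1 := congrArg (𝔠 (𝔭 ^ f.natDegree)) hTf
  rw [h0, h𝔠.apply_twistedTrace hq hcard𝔽 hcard hV, Polynomial.map_pow, aeval_shiftEnd_pow ζ h𝔭,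
    hdiv, aeval_shiftEnd_C, Polynomial.eval_pow] at h1
  set β := h.eval ζ ^ f.natDegree * f.leadingCoeff with hβdef
  have hβ : β ≠ 0 := mul_ne_zero (pow_ne_zero _ hζ) (Polynomial.leadingCoeff_ne_zero.2 hf)
  have h2 : ∀ γ : k, twistedTrace q d V (Polynomial.C γ) = 0 := by
    intro γ
    obtain ⟨a, ha⟩ := hsurj (γ / β)
    have := congrArg (𝔠 a) h1
    rwa [h0, h𝔠.apply_twistedTrace hq hcard𝔽 hcard hV, aeval_shiftEnd_C,
      Polynomial.eval_map_algebraMap, ha, div_mul_cancel₀ _ hβ] at this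
  have h3 := algebraMap_eval_mul_eq_sum_twistedTrace (V := V) hq hd hh 0
  simp_rw [Polynomial.monomial_zero_left, h2, mul_zero] at h3
  rw [Finset.sum_const_zero] at h3
  exact mul_ne_zero ((map_ne_zero _).2 hζ) hV.ne_zero h3

theorem IsCarlitzAction.exists_twistedTrace_eq_and_separable (h𝔠 : IsCarlitzAction q θ 𝔠)
    (hq : 1 < q) (hd : 0 < d) (hcard𝔽 : Fintype.card 𝔽 = q) (hcard : Fintype.card k = q ^ d)
    (hV : IsCarlitzTaylorSystem q d ζ θ V) {𝔭 : Polynomial 𝔽} (hmonic : 𝔭.Monic)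
    (hdeg : 𝔭.natDegree = d) {h : Polynomial k}
    (h𝔭 : 𝔭.map (algebraMap 𝔽 k) = (Polynomial.X - Polynomial.C ζ) * h) (hζ : h.eval ζ ≠ 0)
    (hh : ∀ i, 0 < i → i < d → h.eval (ζ ^ q ^ i) = 0)
    (hsurj : ∀ α : k, ∃ a : Polynomial 𝔽, Polynomial.aeval ζ a = α) [IsAlgClosed L] (n : ℕ) :
    (∀ y, 𝔠 (𝔭 ^ n) y = 0 → ∃ f : Polynomial k, f.degree < n ∧ twistedTrace q d V f = y) ∧
      (carlitzPolynomial q θ (𝔭 ^ n)).Separable := by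
  classical
  have hq0 : 0 < q := by omega
  obtain ⟨hPm, hPd⟩ := carlitzPolynomial_monic (R := L) hq θ (hmonic.pow n)
  set P := carlitzPolynomial q θ (𝔭 ^ n) with hP
  rw [hmonic.natDegree_pow, hdeg] at hPd
  have hf : ∀ c : Fin n → k,
      (((Polynomial.degreeLTEquiv k n).symm c : Polynomial.degreeLT k n) : Polynomial k).degree
        < n := fun c => Polynomial.mem_degreeLT.1 ((Polynomial.degreeLTEquiv k n).symm c).2
  let F : (Fin n → k) → L := fun c =>
    twistedTrace q d V (((Polynomial.degreeLTEquiv k n).symm c : Polynomial.degreeLT k n) :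
      Polynomial k)
  have hadd : ∀ a b, F (a + b) = F a + F b := fun a b => by
    simp only [F, map_add, Submodule.coe_add, twistedTrace_add hq0 hV]
  have hF : Function.Injective F := by
    let F' : (Fin n → k) →+ L := AddMonoidHom.mk' F hadd
    refine (injective_iff_map_eq_zero F').2 fun c hc => ?_
    by_contra hne
    refine h𝔠.twistedTrace_ne_zero hq0 hd hcard𝔽 hcard hV h𝔭 hζ hh hsurj ?_ hc
    simpa using hne
  have hsub : Finset.univ.image F ⊆ P.roots.toFinset := by
    intro y hy
    obtain ⟨c, -, rfl⟩ := Finset.mem_image.1 hy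
    rw [Multiset.mem_toFinset, Polynomial.mem_roots hPm.ne_zero, Polynomial.IsRoot.def,
      ← h𝔠.eq_eval]
    exact h𝔠.apply_twistedTrace_eq_zero hq0 hcard𝔽 hcard hV h𝔭 (hf c)
  have hcardF : (Finset.univ.image F).card = P.natDegree := by
    rw [Finset.card_image_of_injective _ hF, Finset.card_univ, Fintype.card_fun, hcard,
      Fintype.card_fin, hPd, pow_mul, pow_right_comm]
  have hle : P.roots.toFinset.card ≤ Multiset.card P.roots := Multiset.toFinset_card_le _
  have hle2 : Multiset.card P.roots ≤ P.natDegree := P.card_roots'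
  have heq : Finset.univ.image F = P.roots.toFinset :=
    Finset.eq_of_subset_of_card_le hsub (by omega)
  refine ⟨fun y hy => ?_, ?_⟩
  · have : y ∈ Finset.univ.image F := by
      rw [heq, Multiset.mem_toFinset, Polynomial.mem_roots hPm.ne_zero, Polynomial.IsRoot.def,
        ← h𝔠.eq_eval, hy]
    obtain ⟨c, -, rfl⟩ := Finset.mem_image.1 this
    exact ⟨_, hf c, rfl⟩
  · rw [← Polynomial.nodup_roots_iff_of_splits hPm.ne_zero (IsAlgClosed.splits P),
      ← Multiset.toFinset_card_eq_card_iff_nodup]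
    have := congrArg Finset.card heq
    omega

end Torsion

theorem FiniteField.exists_algebraMap_eq_of_pow_card_eq {k L : Type*} [Field k] [Fintype k]
    [Field L] [Algebra k L] {x : L} (hx : x ^ Fintype.card k = x) :
    ∃ a : k, algebraMap k L a = x := by
  have hs := (FiniteField.isSplittingField_sub k k).splits
  rw [Algebra.algebraMap_self, Polynomial.map_id] at hs
  have hne : (Polynomial.X ^ Fintype.card k - Polynomial.X : Polynomial k) ≠ 0 :=
    FiniteField.X_pow_card_sub_X_ne_zero k Fintype.one_lt_card
  have h : x ∈ ((Polynomial.X ^ Fintype.card k - Polynomial.X : Polynomial k).map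
      (algebraMap k L)).roots := by
    rw [Polynomial.mem_roots (Polynomial.map_ne_zero hne)]
    simp [hx]
  rw [hs.roots_map, Multiset.mem_map] at h
  exact h.imp fun a ha => ha.2

section TaylorSystem

variable {k L : Type*} [Field k] [Field L] [Algebra k L] {q d : ℕ} {ζ : k} {θ : L}
  {V : ℕ → ℕ → L}

theorem IsCarlitzTaylorSystem.zero_ne_zero (hV : IsCarlitzTaylorSystem q d ζ θ V)
    (i : ℕ) : V 0 i ≠ 0 := by
  induction i with
  | zero => exact hV.ne_zero
  | succ i ih => exact right_ne_zero_of_mul (hV.zero_pow i ▸ pow_ne_zero q ih)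

theorem IsCarlitzTaylorSystem.sub_ne_zero (hV : IsCarlitzTaylorSystem q d ζ θ V)
    (i : ℕ) : algebraMap k L ζ ^ q ^ (i + 1) - θ ≠ 0 :=
  left_ne_zero_of_mul (hV.zero_pow i ▸ pow_ne_zero q (hV.zero_ne_zero i))

theorem IsCarlitzTaylorSystem.zero_mem (hV : IsCarlitzTaylorSystem q d ζ θ V)
    {S : Subfield L} (hθ : θ ∈ S) (hζ : algebraMap k L ζ ∈ S) (h : V 0 0 ∈ S) (i : ℕ) :
    V 0 i ∈ S := by
  induction i with
  | zero => exact h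
  | succ i ih =>
    rw [eq_div_of_mul_eq (hV.sub_ne_zero i) ((mul_comm _ _).trans (hV.zero_pow i).symm)]
    exact S.div_mem (S.pow_mem ih q) (S.sub_mem (S.pow_mem hζ _) hθ)

theorem IsCarlitzTaylorSystem.mem (hV : IsCarlitzTaylorSystem q d ζ θ V)
    {S : Subfield L} (hθ : θ ∈ S) (hζ : algebraMap k L ζ ∈ S) {n : ℕ}
    (h : ∀ m ≤ n, V m 0 ∈ S) {m : ℕ} (hm : m ≤ n) (i : ℕ) : V m i ∈ S := by
  induction m generalizing i with
  | zero => exact hV.zero_mem hθ hζ (h 0 hm) i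
  | succ m ihm =>
    induction i with
    | zero => exact h _ hm
    | succ i ih =>
      have : V (m + 1) (i + 1) * (algebraMap k L ζ ^ q ^ (i + 1) - θ) =
          V (m + 1) i ^ q - V m (i + 1) := by
        rw [hV.succ_pow]; ring
      rw [eq_div_of_mul_eq (hV.sub_ne_zero i) this]
      exact S.div_mem (S.sub_mem (S.pow_mem ih q) (ihm (by omega) _))
        (S.sub_mem (S.pow_mem hζ _) hθ)

theorem IsCarlitzTaylorSystem.exists_twist [Fintype k] (hcard : Fintype.card k = q ^ d)
    (hV : IsCarlitzTaylorSystem q d ζ θ V) {V' : ℕ → ℕ → L}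
    (h0 : ∀ i, V' 0 i = V 0 i) {n : ℕ} (hper : ∀ m ≤ n, ∀ i, V' m (i + d) = V' m i)
    (hsucc : ∀ m < n, ∀ i, V' (m + 1) i ^ q =
      (algebraMap k L ζ ^ q ^ (i + 1) - θ) * V' (m + 1) (i + 1) + V' m (i + 1)) :
    ∃ a : Fin n → k, ∀ m < n, ∀ i, V' (m + 1) i = V (m + 1) i +
      ∑ j : Fin n, if (j : ℕ) ≤ m then algebraMap k L (a j) ^ q ^ i * V (m - j) i else 0 := by
  induction n with
  | zero => exact ⟨fun _ => 0, fun m hm => absurd hm (Nat.not_lt_zero m)⟩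
  | succ n ih =>
    obtain ⟨a, ha⟩ := ih (fun m hm => hper m (by omega)) (fun m hm => hsucc m (by omega))
    obtain ⟨Fr, hFr⟩ := hV.frobenius
    have hk : ∀ (β : k) i, algebraMap k L β ^ q ^ (i + d) = algebraMap k L β ^ q ^ i :=
      fun β i => by
        rw [add_comm, pow_add, pow_mul, ← map_pow, ← hcard, FiniteField.pow_card]
    let W : ℕ → L := fun i => V (n + 1) i + ∑ j : Fin n, algebraMap k L (a j) ^ q ^ i * V (n - j) i
    have hVn : ∀ i, V' n i =
        V n i + ∑ j : Fin n, algebraMap k L (a j) ^ q ^ i * V (n - 1 - j) i := by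
      intro i
      cases n with
      | zero => simp [h0]
      | succ n =>
        rw [ha n (Nat.lt_succ_self n)]
        congr 1
        refine Finset.sum_congr rfl fun j _ => ?_
        rw [if_pos (Nat.lt_succ_iff.1 j.2), Nat.add_sub_cancel]
    have hW : ∀ i, W i ^ q = (algebraMap k L ζ ^ q ^ (i + 1) - θ) * W (i + 1) + V' n (i + 1) := by
      intro i
      have hterm : ∀ j : Fin n, Fr (algebraMap k L (a j) ^ q ^ i * V (n - j) i) =
          (algebraMap k L ζ ^ q ^ (i + 1) - θ) *
            (algebraMap k L (a j) ^ q ^ (i + 1) * V (n - j) (i + 1)) +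
              algebraMap k L (a j) ^ q ^ (i + 1) * V (n - 1 - j) (i + 1) := by
        intro j
        obtain ⟨e, he⟩ : ∃ e, n - (j : ℕ) = e + 1 := ⟨n - 1 - j, by omega⟩
        have he' : n - 1 - (j : ℕ) = e := by omega
        rw [he, he', map_mul, hFr, hFr, hV.succ_pow, ← pow_mul, ← pow_succ]
        ring
      rw [hVn, ← hFr, map_add, map_sum, Finset.sum_congr rfl fun j _ => hterm j, hFr,
        hV.succ_pow, Finset.sum_add_distrib, ← Finset.mul_sum]
      ring
    have hWd : W d = W 0 := by
      have hVd : ∀ m, V m d = V m 0 := fun m => by simpa using hV.periodic m 0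
      have hkd : ∀ β : k, algebraMap k L β ^ q ^ d = algebraMap k L β ^ q ^ 0 := fun β => by
        simpa using hk β 0
      simp only [W, hVd, hkd]
    let β : ℕ → L := fun i => (V' (n + 1) i - W i) / V 0 i
    have hβ : ∀ i, β i = β 0 ^ q ^ i := by
      intro i
      induction i with
      | zero => simp
      | succ i ih =>
        rw [pow_succ, pow_mul, ← ih]
        have h1 := hV.zero_ne_zero i
        have h2 := hV.zero_ne_zero (i + 1)
        have h3 := hV.sub_ne_zero i
        simp only [β]
        rw [div_pow, ← hFr (_ - _), map_sub, hFr, hFr, hsucc n (Nat.lt_succ_self n), hW,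
          hV.zero_pow, add_sub_add_right_eq_sub, ← mul_sub, mul_div_mul_left _ _ h3]
    have hβd : β d = β 0 := by
      have h1 : V 0 d = V 0 0 := by simpa using hV.periodic 0 0
      have h2 : V' (n + 1) d = V' (n + 1) 0 := by simpa using hper (n + 1) le_rfl 0
      simp only [β, h1, h2, hWd]
    obtain ⟨b, hb⟩ := FiniteField.exists_algebraMap_eq_of_pow_card_eq (k := k) (x := β 0)
      (by rw [hcard, ← hβ, hβd])
    refine ⟨Fin.snoc a b, fun m hm i => ?_⟩
    rw [Fin.sum_univ_castSucc]
    simp only [Fin.snoc_castSucc, Fin.snoc_last, Fin.val_castSucc, Fin.val_last]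
    rcases Nat.lt_succ_iff_lt_or_eq.1 hm with hlt | rfl
    · rw [if_neg (by omega), add_zero, ha m hlt]
    · rw [if_pos le_rfl, hb, ← hβ, Nat.sub_self, div_mul_cancel₀ _ (hV.zero_ne_zero i), ← add_assoc]
      have : ∀ j : Fin m, (j : ℕ) ≤ m := fun j => j.2.le
      simp only [this, if_true]
      simp [W]

end TaylorSystem

section Ramification

variable {k L : Type*} [Field k] [Field L] [Algebra k L] {q d : ℕ} {ζ : k} {θ : L}
  {V : ℕ → ℕ → L}

theorem Transcendental.exists_valuationSubring (hθ : Transcendental k θ) (ζ : k) :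
    ∃ B : ValuationSubring L, B.valuation (θ - algebraMap k L ζ) < 1 ∧
      ∀ f : Polynomial k, f.eval ζ ≠ 0 → B.valuation (Polynomial.aeval θ f) = 1 := by
  let A : Subring L := (Polynomial.aeval θ : Polynomial k →ₐ[k] L).toRingHom.range
  have hA : ∀ f : Polynomial k, Polynomial.aeval θ f ∈ A := fun f => ⟨f, rfl⟩
  have ht : Polynomial.aeval θ (Polynomial.X - Polynomial.C ζ) = θ - algebraMap k L ζ := by simp
  let I : Ideal A := Ideal.span {⟨_, hA (Polynomial.X - Polynomial.C ζ)⟩}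
  have hI : I ≠ ⊤ := by
    intro h
    obtain ⟨⟨_, g, rfl⟩, hg⟩ := Ideal.mem_span_singleton'.1 ((Ideal.eq_top_iff_one I).1 h)
    have h1 : Polynomial.aeval θ (g * (Polynomial.X - Polynomial.C ζ)) =
        Polynomial.aeval θ (1 : Polynomial k) := by
      rw [map_mul, map_one]
      exact congrArg Subtype.val hg
    have h2 := transcendental_iff_injective.1 hθ h1
    simpa using congrArg (Polynomial.eval ζ) h2
  obtain ⟨B, hAB, hIB⟩ := Ideal.image_subset_nonunits_valuationSubring I hI
  have hle : ∀ f : Polynomial k, B.valuation (Polynomial.aeval θ f) ≤ 1 := fun f =>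
    (B.valuation_le_one_iff _).2 (hAB (hA f))
  have hlt : B.valuation (θ - algebraMap k L ζ) < 1 := by
    rw [← ht]
    exact (ValuationSubring.mem_nonunits_iff _).1 (hIB ⟨_, Ideal.mem_span_singleton_self _, rfl⟩)
  refine ⟨B, hlt, fun f hf => ?_⟩
  obtain ⟨g, hg⟩ := Polynomial.X_sub_C_dvd_sub_C_eval (a := ζ) (p := f)
  have hconst : B.valuation (algebraMap k L (f.eval ζ)) = 1 := by
    refine le_antisymm (by simpa using hle (Polynomial.C (f.eval ζ))) ?_
    have := hle (Polynomial.C (f.eval ζ)⁻¹)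
    rw [Polynomial.aeval_C, map_inv₀, map_inv₀] at this
    exact (inv_le_one₀ (zero_lt_iff.2 ((Valuation.ne_zero_iff _).2
      ((map_ne_zero _).2 hf)))).1 this
  rw [sub_eq_iff_eq_add.1 hg, map_add, map_mul, ht, Polynomial.aeval_C,
    Valuation.map_add_eq_of_lt_right, hconst]
  rw [hconst, map_mul]
  exact (mul_le_of_le_one_right' (hle g)).trans_lt hlt

variable {Γ : Type*} [LinearOrderedCommGroupWithZero Γ] {v : Valuation L Γ}

theorem Valuation.exists_zpow_of_mem_adjoin_simple (hθ : Transcendental k θ)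
    (hunit : ∀ f : Polynomial k, f.eval ζ ≠ 0 → v (Polynomial.aeval θ f) = 1) {x : L}
    (hx : x ∈ IntermediateField.adjoin k {θ}) (hx0 : x ≠ 0) :
    ∃ e : ℤ, v x = v (θ - algebraMap k L ζ) ^ e := by
  have hpoly : ∀ f : Polynomial k, f ≠ 0 →
      ∃ e : ℤ, v (Polynomial.aeval θ f) = v (θ - algebraMap k L ζ) ^ e := by
    intro f hf
    obtain ⟨g, hg, hdvd⟩ := Polynomial.exists_eq_pow_rootMultiplicity_mul_and_not_dvd f hf ζ
    refine ⟨f.rootMultiplicity ζ, ?_⟩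
    conv_lhs => rw [hg]
    rw [map_mul, map_mul, hunit g fun h => hdvd (Polynomial.dvd_iff_isRoot.2 h)]
    simp
  obtain ⟨r, s, rfl⟩ := (IntermediateField.mem_adjoin_simple_iff k x).1 hx
  have hr : r ≠ 0 := by rintro rfl; simp at hx0
  have hs : s ≠ 0 := by rintro rfl; simp at hx0
  obtain ⟨e, he⟩ := hpoly r hr
  obtain ⟨e', he'⟩ := hpoly s hs
  have ht : v (θ - algebraMap k L ζ) ≠ 0 := (Valuation.ne_zero_iff _).2 fun h =>
    hθ ((sub_eq_zero.1 h).symm ▸ isAlgebraic_algebraMap ζ)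
  exact ⟨e - e', by rw [map_div₀, he, he', zpow_sub₀ ht]⟩

theorem pow_chain_of_periodic {q e : ℕ} (hq : 1 < q) {a : ℕ → Γ}
    (hper : Function.Periodic a (e + 1)) (ha : ∀ i < e, a i ^ q = a (i + 1)) (h0 : a 0 ≤ 1) :
    a e ^ q = a 0 ^ q ^ (e + 1) ∧ ∀ i, a i ≤ a 0 := by
  have hpow : ∀ i ≤ e, a i = a 0 ^ q ^ i := by
    intro i hi
    induction i with
    | zero => simp
    | succ i ih => rw [← ha i hi, ih (by omega), ← pow_mul, pow_succ]
  refine ⟨by rw [hpow e le_rfl, ← pow_mul, pow_succ], fun i => ?_⟩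
  rw [← hper.map_mod_nat, hpow _ (Nat.le_of_lt_succ (Nat.mod_lt _ (Nat.succ_pos e)))]
  exact pow_le_of_le_one zero_le h0 (pow_pos (by omega) _).ne'

theorem IsCarlitzTaylorSystem.valuation_zero {e : ℕ} (hq : 1 < q)
    (hV : IsCarlitzTaylorSystem q (e + 1) ζ θ V)
    (hunit : ∀ i < e, v (algebraMap k L ζ ^ q ^ (i + 1) - θ) = 1)
    (ht : v (algebraMap k L ζ ^ q ^ (e + 1) - θ) < 1) :
    v (V 0 0) ^ (q ^ (e + 1) - 1) = v (algebraMap k L ζ ^ q ^ (e + 1) - θ) ∧ v (V 0 0) < 1 ∧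
      ∀ i, v (V 0 i) ≤ v (V 0 0) := by
  have hne : v (V 0 0) ≠ 0 := (Valuation.ne_zero_iff _).2 hV.ne_zero
  have hper : Function.Periodic (fun i => v (V 0 i)) (e + 1) := fun i =>
    congrArg v (hV.periodic 0 i)
  have hrec : ∀ i, v (V 0 i) ^ q =
      v (algebraMap k L ζ ^ q ^ (i + 1) - θ) * v (V 0 (i + 1)) := fun i => by
    rw [← map_pow, hV.zero_pow, map_mul]
  have hstep : ∀ i < e, v (V 0 i) ^ q = v (V 0 (i + 1)) := fun i hi => by
    rw [hrec, hunit i hi, one_mul]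
  have hlast : v (V 0 e) ^ q = v (algebraMap k L ζ ^ q ^ (e + 1) - θ) * v (V 0 0) := by
    rw [hrec, ← Nat.zero_add (e + 1), hV.periodic, Nat.zero_add]
  have hpow : ∀ i ≤ e, v (V 0 i) = v (V 0 0) ^ q ^ i := by
    intro i hi
    induction i with
    | zero => simp
    | succ i ih => rw [← hstep i hi, ih (by omega), ← pow_mul, pow_succ]
  have hQ : q ^ (e + 1) - 1 + 1 = q ^ (e + 1) := Nat.sub_add_cancel (Nat.one_le_pow _ _ (by omega))
  have hmain : v (V 0 0) ^ (q ^ (e + 1) - 1) = v (algebraMap k L ζ ^ q ^ (e + 1) - θ) := by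
    refine mul_right_cancel₀ hne ?_
    rw [← pow_succ, hQ, ← hlast, hpow e le_rfl, ← pow_mul, ← pow_succ]
  have hlt : v (V 0 0) < 1 := by
    by_contra! h
    exact (one_le_pow₀ h).not_gt (hmain ▸ ht)
  exact ⟨hmain, hlt, (pow_chain_of_periodic hq hper hstep hlt.le).2⟩

theorem IsCarlitzTaylorSystem.valuation_succ {e : ℕ} (hq : 1 < q)
    (hV : IsCarlitzTaylorSystem q (e + 1) ζ θ V)
    (hunit : ∀ i < e, v (algebraMap k L ζ ^ q ^ (i + 1) - θ) = 1)
    (ht : v (algebraMap k L ζ ^ q ^ (e + 1) - θ) < 1) {m : ℕ}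
    (hm : ∀ i, v (V m i) ≤ v (V m 0)) (hm1 : v (V m 0) < 1)
    (hmt : v (algebraMap k L ζ ^ q ^ (e + 1) - θ) ≤ v (V m 0)) :
    v (V (m + 1) 0) ^ q ^ (e + 1) = v (V m 0) ∧ v (V m 0) ≤ v (V (m + 1) 0) ∧
      v (V (m + 1) 0) < 1 ∧ ∀ i, v (V (m + 1) i) ≤ v (V (m + 1) 0) := by
  have hq0 : q ≠ 0 := by omega
  set t := v (algebraMap k L ζ ^ q ^ (e + 1) - θ) with htdef
  have ht0 : t ≠ 0 := (Valuation.ne_zero_iff _).2 (hV.sub_ne_zero e)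
  have hm0 : v (V m 0) ≠ 0 := fun h => ht0 (le_zero_iff.1 (h ▸ hmt))
  let a : ℕ → Γ := fun i => v (V (m + 1) i)
  have hper : Function.Periodic a (e + 1) := fun i => congrArg v (hV.periodic (m + 1) i)
  have hrec : ∀ i, a i ^ q = v ((algebraMap k L ζ ^ q ^ (i + 1) - θ) * V (m + 1) (i + 1)
      + V m (i + 1)) := fun i => by
    simp only [a]
    rw [← map_pow, hV.succ_pow]
  have hc : ∀ i, v ((algebraMap k L ζ ^ q ^ (i + 1) - θ) * V (m + 1) (i + 1)) =
      v (algebraMap k L ζ ^ q ^ (i + 1) - θ) * a (i + 1) := fun i => map_mul _ _ _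
  have hc1 : ∀ i < e, v ((algebraMap k L ζ ^ q ^ (i + 1) - θ) * V (m + 1) (i + 1)) = a (i + 1) :=
    fun i hi => by rw [hc, hunit i hi, one_mul]
  have hae : a (e + 1) = a 0 := by simpa using hper 0
  have hVme : V m (e + 1) = V m 0 := by simpa using hV.periodic m 0
  have hcle : ∀ i, v (algebraMap k L ζ ^ q ^ (i % (e + 1) + 1) - θ) ≤ 1 := fun i => by
    rcases Nat.lt_succ_iff_lt_or_eq.1 (Nat.mod_lt i (Nat.succ_pos e)) with h | h
    · exact (hunit _ h).le
    · rw [h]; exact ht.le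
  have hle1 : ∀ i, a i ≤ 1 := by
    have hstep : ∀ i, 1 < a i → a i < a (i + 1) := by
      intro i hi
      have hmod : a (i % (e + 1) + 1) = a (i + 1) := by
        rw [← hper.map_mod_nat (i + 1), ← hper.map_mod_nat (i % (e + 1) + 1), Nat.mod_add_mod]
      rw [← hper.map_mod_nat] at hi ⊢
      rw [← hmod]
      have h1 : a (i % (e + 1)) < a (i % (e + 1)) ^ q := lt_self_pow₀ hi hq
      have h2 := (hrec (i % (e + 1))).le.trans (v.map_add _ _)
      rcases le_max_iff.1 h2 with h | h
      · refine h1.trans_le (h.trans ?_)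
        rw [hc]
        exact mul_le_of_le_one_left' (hcle i)
      · exact absurd ((hi.trans h1).trans_le h) ((hm _).trans hm1.le).not_gt
    intro i
    by_contra! hi
    have : ∀ n, a i < a (i + (n + 1)) := by
      intro n
      induction n with
      | zero => exact hstep i hi
      | succ n ih => exact ih.trans (hstep _ (hi.trans ih))
    exact (this e).ne (hper i).symm
  have hlt1 : ∀ j ≤ e, a (e - j) < 1 := by
    intro j hj
    refine (pow_lt_one_iff hq0).1 ?_
    induction j with
    | zero =>
      rw [Nat.sub_zero, hrec]
      refine v.map_add_lt ?_ ((hm _).trans_lt hm1)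
      rw [hc]
      exact (mul_le_of_le_one_right' (hle1 _)).trans_lt ht
    | succ j ih =>
      rw [hrec]
      have he : e - (j + 1) + 1 = e - j := by omega
      refine v.map_add_lt ?_ ((hm _).trans_lt hm1)
      rw [hc1 _ (by omega), he]
      exact (pow_lt_one_iff hq0).1 (ih (by omega))
  have ha0 : a 0 < 1 := by simpa using hlt1 e le_rfl
  have hlast : a e ^ q = v (V m 0) := by
    rw [hrec, v.map_add_eq_of_lt_right, hVme]
    rw [hc, hae, hVme]
    exact (mul_lt_of_lt_one_right (zero_lt_iff.2 ht0) ha0).trans_le hmt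
  have hgt : ∀ j ≤ e, v (V m 0) < a (e - j) ∧ (0 < j → a (e - j) ^ q = a (e - j + 1)) := by
    intro j hj
    have hself : ∀ {x : Γ}, 0 < x ^ q → x < 1 → x ^ q < x := fun {x} h0 h1 =>
      pow_lt_self_of_lt_one₀ (zero_lt_iff.2 fun h => h0.ne' (by rw [h, _root_.zero_pow hq0])) h1 hq
    induction j with
    | zero =>
      refine ⟨?_, fun h => absurd h (lt_irrefl 0)⟩
      have := hself (hlast ▸ zero_lt_iff.2 hm0) (hlt1 0 hj)
      rwa [Nat.sub_zero, hlast] at this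
    | succ j ih =>
      have he : e - (j + 1) + 1 = e - j := by omega
      have h1 := (ih (by omega)).1
      have h2 : a (e - (j + 1)) ^ q = a (e - (j + 1) + 1) := by
        rw [hrec, v.map_add_eq_of_lt_left, hc1 _ (by omega)]
        rw [hc1 _ (by omega), he]
        exact (hm _).trans_lt h1
      refine ⟨h1.trans ?_, fun _ => h2⟩
      have := hself (x := a (e - (j + 1))) (by rw [h2, he]; exact zero_le.trans_lt h1) (hlt1 _ hj)
      rwa [h2, he] at this
  have hstep : ∀ i < e, a i ^ q = a (i + 1) := fun i hi => by
    have := (hgt (e - i) (Nat.sub_le _ _)).2 (by omega)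
    rwa [Nat.sub_sub_self hi.le] at this
  obtain ⟨h1, h2⟩ := pow_chain_of_periodic hq hper hstep ha0.le
  exact ⟨h1.symm.trans hlast, by simpa using (hgt e le_rfl).1.le, ha0, h2⟩

theorem IsCarlitzTaylorSystem.valuation_pow {e : ℕ} (hq : 1 < q)
    (hV : IsCarlitzTaylorSystem q (e + 1) ζ θ V)
    (hunit : ∀ i < e, v (algebraMap k L ζ ^ q ^ (i + 1) - θ) = 1)
    (ht : v (algebraMap k L ζ ^ q ^ (e + 1) - θ) < 1) (m : ℕ) :
    v (V m 0) ^ (q ^ (e + 1)) ^ m = v (V 0 0) ∧ v (V m 0) < 1 := by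
  suffices h : v (V m 0) ^ (q ^ (e + 1)) ^ m = v (V 0 0) ∧ v (V 0 0) ≤ v (V m 0) ∧
      v (V m 0) < 1 ∧ ∀ i, v (V m i) ≤ v (V m 0) from ⟨h.1, h.2.2.1⟩
  obtain ⟨h1, h2, h3⟩ := hV.valuation_zero hq hunit ht
  induction m with
  | zero => exact ⟨by simp, le_rfl, h2, h3⟩
  | succ m ih =>
    obtain ⟨i1, i2, i3, i4⟩ := ih
    have hmt : v (algebraMap k L ζ ^ q ^ (e + 1) - θ) ≤ v (V m 0) := by
      rw [← h1]
      refine le_trans (pow_le_of_le_one zero_le h2.le ?_) i2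
      have : 1 < q ^ (e + 1) := Nat.one_lt_pow (Nat.succ_ne_zero e) hq
      omega
    obtain ⟨j1, j2, j3, j4⟩ := hV.valuation_succ hq hunit ht i4 i3 hmt
    exact ⟨by rw [pow_succ', pow_mul, j1, i1], i2.trans j2, j3, j4⟩

theorem IsCarlitzTaylorSystem.exists_eval_eq_of_mem_adjoin (hq : 1 < q) (hd : 0 < d)
    (hV : IsCarlitzTaylorSystem q d ζ θ V) {x : L}
    (hx : x ∈ IntermediateField.adjoin (IntermediateField.adjoin k {θ}) {V 0 0}) :
    ∃ f : Polynomial L, (∀ i, f.coeff i ∈ IntermediateField.adjoin k {θ}) ∧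
      f.natDegree < q ^ d - 1 ∧ f.eval (V 0 0) = x := by
  set F := IntermediateField.adjoin k {θ} with hF
  have hθF : θ ∈ F := IntermediateField.mem_adjoin_simple_self k θ
  have hpow : ∀ i, ∃ c ∈ F, V 0 0 ^ q ^ i = c * V 0 i := by
    intro i
    induction i with
    | zero => exact ⟨1, F.one_mem, by simp⟩
    | succ i ih =>
      obtain ⟨c, hc, h⟩ := ih
      refine ⟨c ^ q * (algebraMap k L ζ ^ q ^ (i + 1) - θ), F.mul_mem (pow_mem hc q)
        (F.sub_mem (pow_mem (F.algebraMap_mem ζ) _) hθF), ?_⟩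
      have hp : V 0 0 ^ q ^ (i + 1) = (V 0 0 ^ q ^ i) ^ q := by rw [← pow_mul, pow_succ]
      rw [hp, h, mul_pow, hV.zero_pow, mul_assoc]
  have hQ : 1 < q ^ d := Nat.one_lt_pow hd.ne' hq
  obtain ⟨c, hc, h⟩ := hpow d
  have hVd : V 0 d = V 0 0 := by simpa using hV.periodic 0 0
  have hc' : V 0 0 ^ (q ^ d - 1) = c := by
    refine mul_right_cancel₀ hV.ne_zero ?_
    rw [← pow_succ, Nat.sub_add_cancel hQ.le, h, hVd]
  let M : Polynomial F := Polynomial.X ^ (q ^ d - 1) - Polynomial.C ⟨c, hc⟩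
  have hQ' : q ^ d - 1 ≠ 0 := by omega
  have hM : M.Monic := Polynomial.monic_X_pow_sub_C _ hQ'
  have hMd : M.natDegree = q ^ d - 1 := Polynomial.natDegree_X_pow_sub_C
  have hMr : Polynomial.aeval (V 0 0) M = 0 := by
    simp only [M, map_sub, map_pow, Polynomial.aeval_X, Polynomial.aeval_C, hc']
    exact sub_self c
  have hint : IsAlgebraic F (V 0 0) := ⟨M, hM.ne_zero, hMr⟩
  have hx' : x ∈ Algebra.adjoin F {V 0 0} := by
    rwa [← IntermediateField.adjoin_simple_toSubalgebra_of_isAlgebraic hint]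
  rw [Algebra.adjoin_singleton_eq_range_aeval] at hx'
  obtain ⟨g, rfl⟩ := hx'
  refine ⟨(g %ₘ M).map (algebraMap F L), fun i => ?_, ?_, ?_⟩
  · rw [Polynomial.coeff_map]
    exact SetLike.coe_mem _
  · refine Polynomial.natDegree_map_le.trans_lt (hMd ▸ Polynomial.natDegree_modByMonic_lt g hM ?_)
    intro h1
    rw [h1, Polynomial.natDegree_one] at hMd
    exact hQ' hMd.symm
  · rw [Polynomial.eval_map_algebraMap]
    exact Polynomial.aeval_modByMonic_eq_self_of_root hMr

theorem IsCarlitzTaylorSystem.eval_ne_zero [Fintype k] (hq : 1 < q) (hd : 0 < d)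
    (hcard : Fintype.card k = q ^ d) (hV : IsCarlitzTaylorSystem q d ζ θ V)
    (hζ : ∀ i, 0 < i → i < d → ζ ^ q ^ i ≠ ζ) (hθ : Transcendental k θ) {E : Subfield L}
    (hE : ∀ x ∈ E, x ∈ IntermediateField.adjoin (IntermediateField.adjoin k {θ}) {V 0 0}) {n : ℕ}
    {f : Polynomial L} (hf0 : f ≠ 0) (hf : ∀ i, f.coeff i ∈ E)
    (hdeg : f.natDegree < (q ^ d) ^ n) : f.eval (V n 0) ≠ 0 := by
  obtain ⟨e, rfl⟩ : ∃ e, d = e + 1 := ⟨d - 1, by omega⟩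
  obtain ⟨B, hB, hunit⟩ := hθ.exists_valuationSubring ζ
  have ht : B.valuation (algebraMap k L ζ ^ q ^ (e + 1) - θ) =
      B.valuation (θ - algebraMap k L ζ) := by
    rw [← map_pow, ← hcard, FiniteField.pow_card, Valuation.map_sub_swap]
  have hu : ∀ i < e, B.valuation (algebraMap k L ζ ^ q ^ (i + 1) - θ) = 1 := by
    intro i hi
    have := hunit (Polynomial.C (ζ ^ q ^ (i + 1)) - Polynomial.X) (by
      rw [Polynomial.eval_sub, Polynomial.eval_C, Polynomial.eval_X]
      exact _root_.sub_ne_zero.2 (hζ (i + 1) (Nat.succ_pos i) (by omega)))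
    simpa using this
  have ht1 := ht.trans_lt hB
  obtain ⟨h1, h2, -⟩ := hV.valuation_zero hq hu ht1
  obtain ⟨h3, h4⟩ := hV.valuation_pow hq hu ht1 n
  have hV0 : B.valuation (V 0 0) ≠ 0 := (Valuation.ne_zero_iff _).2 hV.ne_zero
  have hQ : (q ^ (e + 1)) ^ n ≠ 0 := by positivity
  have hVn : V n 0 ≠ 0 := (Valuation.ne_zero_iff B.valuation).1 fun h =>
    hV0 (by rw [← h3, h, _root_.zero_pow hQ])
  have hEv : ∀ x ∈ E, x ≠ 0 → ∃ e : ℤ, B.valuation x = B.valuation (V 0 0) ^ e := by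
    intro x hx hx0
    obtain ⟨g, hg, hgd, rfl⟩ := hV.exists_eval_eq_of_mem_adjoin hq hd (hE x hx)
    refine Valuation.exists_zpow_eval B.valuation (IntermediateField.adjoin k {θ}).toSubfield
      (h1.trans ht) hV.ne_zero h2 (fun y hy hy0 => ?_) hg hgd ?_
    · exact Valuation.exists_zpow_of_mem_adjoin_simple hθ hunit hy hy0
    · rintro rfl
      simp at hx0
  obtain ⟨z, hz⟩ := Valuation.exists_zpow_eval B.valuation E h3 hVn h4 hEv hf hdeg hf0
  refine (Valuation.ne_zero_iff B.valuation).1 ?_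
  rw [hz]
  exact zpow_ne_zero _ ((Valuation.ne_zero_iff _).2 hVn)

end Ramification

/-- The extension of `E` generated by the `a`-torsion. -/
abbrev torsionField {𝔽 L : Type*} [Field 𝔽] [Field L] [Algebra 𝔽 L] (E : IntermediateField 𝔽 L)
    (𝔠 : Polynomial 𝔽 → L → L) (a : Polynomial 𝔽) : IntermediateField E L :=
  IntermediateField.adjoin E {y | 𝔠 a y = 0}

/-- The data relating the Taylor coefficients `V` of the Anderson–Thakur function at the conjugates
of a root `ζ` of `𝔭` to the Carlitz action `𝔠`. -/
structure IsCarlitzPrimeSystem {𝔽 k L : Type*} [Field 𝔽] [Fintype 𝔽] [Field k] [Fintype k]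
    [Field L] [Algebra 𝔽 k] [Algebra k L] [Algebra 𝔽 L] (q d : ℕ) (ζ : k) (θ : L)
    (V : ℕ → ℕ → L) (𝔠 : Polynomial 𝔽 → L → L) (𝔭 : Polynomial 𝔽) : Prop where
  one_lt : 1 < q
  pos : 0 < d
  card_base : Fintype.card 𝔽 = q
  card_top : Fintype.card k = q ^ d
  system : IsCarlitzTaylorSystem q d ζ θ V
  action : IsCarlitzAction q θ 𝔠
  monic : 𝔭.Monic
  natDegree_eq : 𝔭.natDegree = d
  irreducible : Irreducible 𝔭
  root : Polynomial.aeval ζ 𝔭 = 0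
  surj : ∀ α : k, ∃ a : Polynomial 𝔽, Polynomial.aeval ζ a = α
  pow_ne : ∀ i, 0 < i → i < d → ζ ^ q ^ i ≠ ζ
  transcendental : Transcendental k θ

namespace IsCarlitzPrimeSystem

variable {𝔽 k L : Type*} [Field 𝔽] [Fintype 𝔽] [Field k] [Fintype k]
  [Field L] [Algebra 𝔽 k] [Algebra k L] [Algebra 𝔽 L] {q d : ℕ} {ζ : k}
  {θ : L} {V : ℕ → ℕ → L} {𝔠 : Polynomial 𝔽 → L → L} {𝔭 : Polynomial 𝔽}

theorem exists_cofactor (H : IsCarlitzPrimeSystem q d ζ θ V 𝔠 𝔭) : ∃ h : Polynomial k,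
    𝔭.map (algebraMap 𝔽 k) = (Polynomial.X - Polynomial.C ζ) * h ∧ h.eval ζ ≠ 0 ∧
      ∀ i, 0 < i → i < d → h.eval (ζ ^ q ^ i) = 0 := by
  have hroot : (𝔭.map (algebraMap 𝔽 k)).IsRoot ζ := by
    rw [Polynomial.IsRoot.def, Polynomial.eval_map_algebraMap, H.root]
  obtain ⟨h, hh⟩ := Polynomial.dvd_iff_isRoot.2 hroot
  refine ⟨h, hh, fun h0 => ?_, fun i hi hid => ?_⟩
  · have hsep : (𝔭.map (algebraMap 𝔽 k)).Separable :=
      (PerfectField.separable_of_irreducible H.irreducible).map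
    obtain ⟨g, rfl⟩ := Polynomial.dvd_iff_isRoot.2 h0
    refine Polynomial.not_isUnit_X_sub_C ζ (hsep.squarefree _ ⟨g, ?_⟩)
    rw [hh, mul_assoc]
  · have hpow : Polynomial.aeval (ζ ^ q ^ i) 𝔭 = 0 := by
      rw [← H.card_base]
      clear hid hi
      induction i with
      | zero => rw [pow_zero, pow_one, H.root]
      | succ i ih =>
        rw [pow_succ, pow_mul, ← FiniteField.frobeniusAlgHom_apply, Polynomial.aeval_algHom_apply,
          ih, map_zero]
    have := congrArg (Polynomial.eval (ζ ^ q ^ i)) hh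
    rw [Polynomial.eval_map_algebraMap, hpow, Polynomial.eval_mul, Polynomial.eval_sub,
      Polynomial.eval_X, Polynomial.eval_C] at this
    exact (mul_eq_zero.1 this.symm).resolve_left (sub_ne_zero.2 (H.pow_ne i hi hid))

variable [IsScalarTower 𝔽 k L]

theorem torsion_subset_iff [IsAlgClosed L] (H : IsCarlitzPrimeSystem q d ζ θ V 𝔠 𝔭)
    {S : Subfield L} (hk : ∀ α, algebraMap k L α ∈ S) (hθ : θ ∈ S) (n : ℕ) :
    {y | 𝔠 (𝔭 ^ (n + 1)) y = 0} ⊆ S ↔ ∀ m ≤ n, ∀ i, V m i ∈ S := by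
  obtain ⟨h, h𝔭, hζ, hh⟩ := H.exists_cofactor
  have hq := H.one_lt.le
  constructor
  · intro hS m hm i
    refine H.system.mem hθ (hk ζ) (fun m hm => ?_) hm i
    have h0 : algebraMap k L (h.eval ζ) ≠ 0 := (map_ne_zero _).2 hζ
    rw [← mul_div_cancel_left₀ (V m 0) h0,
      algebraMap_eval_mul_eq_sum_twistedTrace (d := d) (V := V) hq H.pos hh]
    refine S.div_mem (S.sum_mem fun j _ => S.mul_mem (hk _) (hS ?_)) (hk _)
    refine H.action.apply_twistedTrace_eq_zero hq H.card_base H.card_top H.system h𝔭 ?_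
    exact (Polynomial.degree_monomial_le _ _).trans_lt (by exact_mod_cast Nat.lt_succ_of_le hm)
  · intro hS y hy
    obtain ⟨f, hf, rfl⟩ := (H.action.exists_twistedTrace_eq_and_separable H.one_lt H.pos
      H.card_base H.card_top H.system H.monic H.natDegree_eq h𝔭 hζ hh H.surj (n + 1)).1 y hy
    refine S.sum_mem fun m hm => S.sum_mem fun i _ => S.mul_mem (S.pow_mem (hk _) _) (hS m ?_ i)
    have : (m : WithBot ℕ) < (n + 1 : ℕ) := (Polynomial.le_degree_of_mem_supp m hm).trans_lt hf
    exact Nat.le_of_lt_succ (by exact_mod_cast this)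

section Galois

variable [IsAlgClosed L] {E : IntermediateField 𝔽 L}

theorem mem_adjoin_torsion (H : IsCarlitzPrimeSystem q d ζ θ V 𝔠 𝔭)
    (hk : ∀ α, algebraMap k L α ∈ E) (hθ : θ ∈ E) {n m : ℕ} (hm : m ≤ n) (i : ℕ) :
    V m i ∈ torsionField E 𝔠 (𝔭 ^ (n + 1)) :=
  (H.torsion_subset_iff
    (S := (torsionField E 𝔠 (𝔭 ^ (n + 1))).toSubfield)
    (fun α => IntermediateField.algebraMap_mem _ (⟨_, hk α⟩ : E))
    (IntermediateField.algebraMap_mem _ (⟨θ, hθ⟩ : E)) n).1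
    (IntermediateField.subset_adjoin E _) m hm i

theorem adjoin_torsion_eq (H : IsCarlitzPrimeSystem q d ζ θ V 𝔠 𝔭)
    (hk : ∀ α, algebraMap k L α ∈ E) (hθ : θ ∈ E) (n : ℕ) :
    torsionField E 𝔠 (𝔭 ^ (n + 1)) =
      IntermediateField.adjoin E {y | ∃ m ≤ n, ∃ i, y = V m i} := by
  refine le_antisymm (IntermediateField.adjoin_le_iff.2 ?_) (IntermediateField.adjoin_le_iff.2 ?_)
  · exact (H.torsion_subset_iff
      (S := (IntermediateField.adjoin E {y | ∃ m ≤ n, ∃ i, y = V m i}).toSubfield)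
      (fun α => IntermediateField.algebraMap_mem _ (⟨_, hk α⟩ : E))
      (IntermediateField.algebraMap_mem _ (⟨θ, hθ⟩ : E)) n).2
      fun m hm i => IntermediateField.subset_adjoin E _ ⟨m, hm, i, rfl⟩
  · rintro _ ⟨m, hm, i, rfl⟩
    exact H.mem_adjoin_torsion hk hθ hm i

theorem finiteDimensional_and_isGalois (H : IsCarlitzPrimeSystem q d ζ θ V 𝔠 𝔭) (hθ : θ ∈ E)
    (n : ℕ) :
    FiniteDimensional E (torsionField E 𝔠 (𝔭 ^ (n + 1))) ∧
      IsGalois E (torsionField E 𝔠 (𝔭 ^ (n + 1))) := by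
  obtain ⟨h, h𝔭, hζ, hh⟩ := H.exists_cofactor
  set P : Polynomial E := carlitzPolynomial q (⟨θ, hθ⟩ : E) (𝔭 ^ (n + 1)) with hP
  have hmap : P.map (algebraMap E L) = carlitzPolynomial q θ (𝔭 ^ (n + 1)) :=
    carlitzPolynomial_map E.val q _ _
  have hsep : (carlitzPolynomial q θ (𝔭 ^ (n + 1))).Separable :=
    (H.action.exists_twistedTrace_eq_and_separable H.one_lt H.pos
      H.card_base H.card_top H.system H.monic H.natDegree_eq h𝔭 hζ hh H.surj (n + 1)).2
  have hroot : {y | 𝔠 (𝔭 ^ (n + 1)) y = 0} = P.rootSet L := by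
    ext y
    rw [Polynomial.mem_rootSet', hmap, ← Polynomial.eval_map_algebraMap, hmap, Set.mem_ofPred,
      H.action.eq_eval]
    exact ⟨fun hy => ⟨hsep.ne_zero, hy⟩, And.right⟩
  rw [torsionField, hroot]
  have := IntermediateField.adjoin_rootSet_isSplittingField
    (IsAlgClosed.splits (P.map (algebraMap E L)))
  exact ⟨Polynomial.IsSplittingField.finiteDimensional _ P,
    IsGalois.of_separable_splitting_field (p := P) ((Polynomial.separable_map (algebraMap E L)).1
      (hmap ▸ hsep))⟩

theorem pow_le_finrank (H : IsCarlitzPrimeSystem q d ζ θ V 𝔠 𝔭)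
    (hk : ∀ α, algebraMap k L α ∈ E) (hθ : θ ∈ E)
    (hE : ∀ x ∈ E, x ∈ IntermediateField.adjoin (IntermediateField.adjoin k {θ}) {V 0 0}) (n : ℕ) :
    (q ^ d) ^ n ≤
      Module.finrank E (torsionField E 𝔠 (𝔭 ^ (n + 1))) := by
  have := (H.finiteDimensional_and_isGalois hθ n).1
  let u : torsionField E 𝔠 (𝔭 ^ (n + 1)) := ⟨V n 0, H.mem_adjoin_torsion hk hθ le_rfl 0⟩
  have : Module.Free E (torsionField E 𝔠 (𝔭 ^ (n + 1))) := Module.Free.of_divisionRing _ _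
  by_contra! hlt
  have hint : IsIntegral E u := IsIntegral.of_finite E u
  refine H.system.eval_ne_zero (E := E.toSubfield) (n := n)
    (f := (minpoly E u).map (algebraMap E L)) H.one_lt H.pos H.card_top
    H.pow_ne H.transcendental hE ?_ (fun i => ?_) ?_ ?_
  · exact Polynomial.map_ne_zero (minpoly.ne_zero hint)
  · rw [Polynomial.coeff_map]
    exact ((minpoly E u).coeff i).2
  · rw [Polynomial.natDegree_map]
    exact (minpoly.natDegree_le u).trans_lt hlt
  · rw [Polynomial.eval_map_algebraMap]
    have := congrArg (algebraMap (torsionField E 𝔠 (𝔭 ^ (n + 1))) L) (minpoly.aeval E u)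
    rwa [← Polynomial.aeval_algebraMap_apply, map_zero] at this

theorem exists_twist (H : IsCarlitzPrimeSystem q d ζ θ V 𝔠 𝔭)
    (hk : ∀ α, algebraMap k L α ∈ E) (hθ : θ ∈ E) (h0 : ∀ i, V 0 i ∈ E) {n : ℕ}
    (s : torsionField E 𝔠 (𝔭 ^ (n + 1)) →ₐ[E] L) :
    ∃ a : Fin n → k, ∀ m (hm : m < n), ∀ i,
      s ⟨V (m + 1) i, H.mem_adjoin_torsion hk hθ hm i⟩ = V (m + 1) i +
        ∑ j : Fin n, if (j : ℕ) ≤ m then algebraMap k L (a j) ^ q ^ i * V (m - j) i else 0 := by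
  have hs : ∀ (x : L) (hx : x ∈ E), s ⟨x, IntermediateField.algebraMap_mem _ (⟨x, hx⟩ : E)⟩ = x :=
    fun x hx => s.commutes ⟨x, hx⟩
  let V' : ℕ → ℕ → L := fun m i =>
    if hm : m ≤ n then s ⟨V m i, H.mem_adjoin_torsion hk hθ hm i⟩ else 0
  have hV' : ∀ {m} (hm : m ≤ n) i, V' m i = s ⟨V m i, H.mem_adjoin_torsion hk hθ hm i⟩ :=
    fun hm i => dif_pos hm
  obtain ⟨a, ha⟩ := H.system.exists_twist (V' := V') (n := n) H.card_top
    (fun i => by rw [hV' (Nat.zero_le n), hs _ (h0 i)])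
    (fun m hm i => by simp only [hV' hm, H.system.periodic])
    (fun m hm i => by
      have hx : algebraMap k L ζ ^ q ^ (i + 1) - θ ∈ E :=
        sub_mem (pow_mem (hk ζ) _) hθ
      rw [hV' (Nat.succ_le_of_lt hm), hV' (Nat.succ_le_of_lt hm), hV' hm.le, ← hs _ hx, ← map_pow,
        ← map_mul, ← map_add]
      exact congrArg s (Subtype.ext (H.system.succ_pow m i)))
  exact ⟨a, fun m hm i => (hV' (Nat.succ_le_of_lt hm) i).symm.trans (ha m hm i)⟩

theorem linearIndependent_conjugates (H : IsCarlitzPrimeSystem q d ζ θ V 𝔠 𝔭)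
    (hk : ∀ α, algebraMap k L α ∈ E) (hθ : θ ∈ E) (h0 : ∀ i, V 0 i ∈ E)
    (hE : ∀ x ∈ E, x ∈ IntermediateField.adjoin (IntermediateField.adjoin k {θ}) {V 0 0}) (n : ℕ)
    (η : torsionField E 𝔠 (𝔭 ^ (n + 1)))
    (hη : (η : L) = ∏ m ∈ Finset.range n, ∏ i ∈ Finset.range d, V (m + 1) i ^ (q - 1)) :
    LinearIndependent E (fun σ : Gal(torsionField E 𝔠 (𝔭 ^ (n + 1))/E)
      => σ η) := by
  have hfin := (H.finiteDimensional_and_isGalois hθ n).1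
  have hgal := (H.finiteDimensional_and_isGalois hθ n).2
  have hrank := H.pow_le_finrank hk hθ hE n
  have htw := fun s => H.exists_twist hk hθ h0 (n := n) s
  have hMeq := H.adjoin_torsion_eq hk hθ n
  have hmem : ∀ {m}, m ≤ n → ∀ i, _ := fun hm i => H.mem_adjoin_torsion hk hθ (n := n) hm i
  choose A hA using htw
  let F : Gal(torsionField E 𝔠 (𝔭 ^ (n + 1))/E) → Fin n → k := fun σ =>
    A ((torsionField E 𝔠 (𝔭 ^ (n + 1))).val.comp σ.toAlgHom)
  have hF : ∀ (σ : Gal(torsionField E 𝔠 (𝔭 ^ (n + 1))/E)) m (hm : m < n) i,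
      (σ ⟨V (m + 1) i, hmem hm i⟩ : L) = V (m + 1) i + ∑ j : Fin n,
        if (j : ℕ) ≤ m then algebraMap k L (F σ j) ^ q ^ i * V (m - j) i else 0 :=
    fun σ => hA ((torsionField E 𝔠 (𝔭 ^ (n + 1))).val.comp σ.toAlgHom)
  have hinj : Function.Injective F := by
    intro σ τ hστ
    have : (torsionField E 𝔠 (𝔭 ^ (n + 1))).val.comp σ.toAlgHom =
        (torsionField E 𝔠 (𝔭 ^ (n + 1))).val.comp τ.toAlgHom := by
      refine IntermediateField.algHom_ext_of_eq_adjoin _ hMeq ?_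
      rintro _ ⟨m, hm, i, rfl⟩
      cases m with
      | zero =>
        exact (((torsionField E 𝔠 (𝔭 ^ (n + 1))).val.comp σ.toAlgHom).commutes ⟨_, h0 i⟩).trans
          (((torsionField E 𝔠 (𝔭 ^ (n + 1))).val.comp τ.toAlgHom).commutes ⟨_, h0 i⟩).symm
      | succ m => exact ((hF σ m hm i).trans (hστ ▸ rfl)).trans (hF τ m hm i).symm
    ext x
    exact DFunLike.congr_fun this x
  have hbij : Function.Bijective F := by
    refine (Nat.bijective_iff_injective_and_card F).2 ⟨hinj, ?_⟩
    refine le_antisymm (Nat.card_le_card_of_injective F hinj) ?_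
    rw [IsGalois.card_aut_eq_finrank]
    simpa [Nat.card_eq_fintype_card, H.card_top] using hrank
  obtain ⟨p, hp⟩ := CharP.exists k
  have : Fact p.Prime := ⟨CharP.char_is_prime k p⟩
  have : CharP E p := (Algebra.charP_iff E L p).2 ((Algebra.charP_iff k L p).1 hp)
  obtain ⟨e, -, he⟩ := FiniteField.card k p
  have hG : IsPGroup p Gal(torsionField E 𝔠 (𝔭 ^ (n + 1))/E) := by
    refine IsPGroup.of_card (n := e * n) ?_
    rw [Nat.card_eq_of_bijective F hbij]
    simp [he, pow_mul]
  refine linearIndependent_conjugates_of_sum_ne_zero p hG η fun hsum => ?_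
  have hsum' : ∑ σ : Gal(torsionField E 𝔠 (𝔭 ^ (n + 1))/E), (σ η : L) = 0 := by
    rw [← (torsionField E 𝔠 (𝔭 ^ (n + 1))).val.map_zero, ← hsum, map_sum]
    rfl
  have hση : ∀ σ : Gal(torsionField E 𝔠 (𝔭 ^ (n + 1))/E), (σ η : L) =
      ∏ m ∈ Finset.range n, ∏ i ∈ Finset.range d, (V (m + 1) i + ∑ j : Fin n,
        if (j : ℕ) ≤ m then algebraMap k L (F σ j) ^ q ^ i * V (m - j) i else 0) ^ (q - 1) := by
    intro σ
    have : η = ∏ m : Fin n, ∏ i ∈ Finset.range d, ⟨V (m + 1) i, hmem m.2 i⟩ ^ (q - 1) := by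
      apply Subtype.ext
      rw [hη, Finset.prod_range]
      simp
    rw [Finset.prod_range, this, map_prod, SubmonoidClass.coe_finsetProd]
    refine Finset.prod_congr rfl fun m _ => ?_
    rw [map_prod, SubmonoidClass.coe_finsetProd]
    refine Finset.prod_congr rfl fun i _ => ?_
    rw [map_pow, IntermediateField.coe_pow, hF σ m m.2]
  simp only [hση] at hsum'
  rw [hbij.sum_comp fun a : Fin n → k => ∏ m ∈ Finset.range n, ∏ i ∈ Finset.range d,
      (V (m + 1) i + ∑ j : Fin n,
        if (j : ℕ) ≤ m then algebraMap k L (a j) ^ q ^ i * V (m - j) i else 0) ^ (q - 1),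
    sum_prod_prod_add_pow_mul (algebraMap k L) H.one_lt H.card_top] at hsum'
  refine pow_ne_zero n (neg_ne_zero.2 (Finset.prod_ne_zero_iff.2 fun i _ => ?_)) hsum'
  exact pow_ne_zero _ (H.system.zero_ne_zero i)

end Galois

end IsCarlitzPrimeSystem

section NormalBasis

variable {E L : Type*} [Field E] [Field L] [Algebra E L] {M : IntermediateField E L}

theorem IntermediateField.mem_range_conjugates_iff (η : M) (y : L) :
    y ∈ Set.range (fun σ : Gal(M/E) => (σ η : L)) ↔ ∃ σ : L → L,
      (∀ x ∈ M, ∀ x' ∈ M, σ (x + x') = σ x + σ x') ∧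
      (∀ x ∈ M, ∀ x' ∈ M, σ (x * x') = σ x * σ x') ∧
      Set.BijOn σ M M ∧ (∀ x, σ (algebraMap E L x) = algebraMap E L x) ∧ y = σ η := by
  classical
  constructor
  · rintro ⟨σ, rfl⟩
    let s : L → L := fun x => if hx : x ∈ M then σ ⟨x, hx⟩ else 0
    have hs : ∀ x : M, s x = σ x := fun x => dif_pos x.2
    refine ⟨s, fun x hx x' hx' => ?_, fun x hx x' hx' => ?_, ⟨fun x hx => ?_, ?_, ?_⟩, fun x => ?_,
      (hs η).symm⟩
    · rw [hs ⟨x, hx⟩, hs ⟨x', hx'⟩]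
      exact (hs (⟨x, hx⟩ + ⟨x', hx'⟩)).trans (congrArg Subtype.val (map_add σ _ _))
    · rw [hs ⟨x, hx⟩, hs ⟨x', hx'⟩]
      exact (hs (⟨x, hx⟩ * ⟨x', hx'⟩)).trans (congrArg Subtype.val (map_mul σ _ _))
    · rw [hs ⟨x, hx⟩]
      exact (σ ⟨x, hx⟩).2
    · intro x hx x' hx' h
      rw [hs ⟨x, hx⟩, hs ⟨x', hx'⟩] at h
      exact congrArg Subtype.val (σ.injective (Subtype.ext h))
    · intro x hx
      refine ⟨σ.symm ⟨x, hx⟩, (σ.symm ⟨x, hx⟩).2, ?_⟩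
      rw [hs, σ.apply_symm_apply]
    · exact (hs (algebraMap E M x)).trans (congrArg Subtype.val (σ.commutes x))
  · rintro ⟨s, hadd, hmul, hbij, hfix, rfl⟩
    let φ : M →ₐ[E] M :=
      { toFun := fun x => ⟨s x, hbij.mapsTo x.2⟩
        map_one' := Subtype.ext ((congrArg s (map_one (algebraMap E L)).symm).trans
          ((hfix 1).trans (map_one _)))
        map_zero' := Subtype.ext ((congrArg s (map_zero (algebraMap E L)).symm).trans
          ((hfix 0).trans (map_zero _)))
        map_add' := fun x y => Subtype.ext (hadd x x.2 y y.2)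
        map_mul' := fun x y => Subtype.ext (hmul x x.2 y y.2)
        commutes' := fun x => Subtype.ext (hfix x) }
    have hφ : Function.Bijective φ := by
      refine ⟨φ.toRingHom.injective, fun y => ?_⟩
      obtain ⟨x, hx, hxy⟩ := hbij.surjOn y.2
      exact ⟨⟨x, hx⟩, Subtype.ext hxy⟩
    exact ⟨AlgEquiv.ofBijective φ hφ, rfl⟩

theorem IntermediateField.existsUnique_finsum_conjugates [FiniteDimensional E M] [IsGalois E M]
    {η : M} (hη : LinearIndependent E (fun σ : Gal(M/E) => σ η)) {x : L} (hx : x ∈ M) :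
    ∃! c : L → L, (∀ y, c y ∈ Set.range (algebraMap E L)) ∧
      (∀ y, c y ≠ 0 → y ∈ Set.range (fun σ : Gal(M/E) => (σ η : L))) ∧
      x = ∑ᶠ y, c y * y := by
  classical
  set f : Gal(M/E) → L := fun σ => (σ η : L) with hf
  have hinj : Function.Injective f := Subtype.val_injective.comp hη.injective
  have hsum : ∀ c : L → L, (∀ y, c y ≠ 0 → y ∈ Set.range f) →
      ∑ᶠ y, c y * y = ∑ σ, c (f σ) * f σ := by
    intro c hc
    rw [finsum_eq_sum_of_support_subset (s := Finset.univ.image f),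
      Finset.sum_image hinj.injOn]
    intro y hy
    simpa using hc y (left_ne_zero_of_mul hy)
  have hval : ∀ g : Gal(M/E) → E, ((∑ σ, g σ • σ η : M) : L) = ∑ σ, algebraMap E L (g σ) * f σ := by
    intro g
    rw [← M.val_apply, map_sum]
    refine Finset.sum_congr rfl fun σ _ => ?_
    rw [map_smul, Algebra.smul_def]
    rfl
  have hcard : Fintype.card Gal(M/E) = Module.finrank E M := by
    rw [← Nat.card_eq_fintype_card, IsGalois.card_aut_eq_finrank]
  let b := basisOfLinearIndependentOfCardEqFinrank hη hcard
  refine ⟨Function.extend f (fun σ => algebraMap E L (b.repr ⟨x, hx⟩ σ)) 0, ⟨fun y => ?_,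
    fun y => ?_, ?_⟩, ?_⟩
  · by_cases hy : ∃ σ, f σ = y
    · obtain ⟨σ, rfl⟩ := hy
      rw [hinj.extend_apply]
      exact ⟨_, rfl⟩
    · rw [Function.extend_apply' _ _ _ hy]
      exact ⟨0, map_zero _⟩
  · intro hy
    by_contra h
    exact hy (Function.extend_apply' _ _ _ h)
  · rw [hsum]
    · simp only [hinj.extend_apply]
      rw [← hval]
      have := b.sum_repr ⟨x, hx⟩
      simp only [b, coe_basisOfLinearIndependentOfCardEqFinrank] at this
      exact (congrArg Subtype.val this).symm
    · intro y hy
      by_contra h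
      exact hy (Function.extend_apply' _ _ _ h)
  · rintro c ⟨hc, hcf, hxc⟩
    choose g hg using hc
    rw [hsum c hcf] at hxc
    have hxb : (⟨x, hx⟩ : M) = ∑ σ, g (f σ) • b σ := by
      apply Subtype.ext
      simp only [b, coe_basisOfLinearIndependentOfCardEqFinrank, hval, hg]
      exact hxc
    have hrepr : ∀ σ, b.repr ⟨x, hx⟩ σ = g (f σ) := fun σ => by
      rw [hxb, b.repr_sum_self]
    funext y
    by_cases hy : ∃ σ, f σ = y
    · obtain ⟨σ, rfl⟩ := hy
      rw [hinj.extend_apply, hrepr, hg]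
    · rw [Function.extend_apply' _ _ _ hy]
      by_contra h
      exact hy (hcf y h)

end NormalBasis

namespace FiniteField

theorem norm_le_one {k L : Type*} [Field k] [Finite k] [NormedField L] (φ : k →+* L) (a : k) :
    ‖φ a‖ ≤ 1 := by
  have := Fintype.ofFinite k
  by_contra! h
  have hpow := congrArg norm (congrArg φ (FiniteField.pow_card a))
  rw [map_pow, norm_pow] at hpow
  exact (lt_self_pow₀ h Fintype.one_lt_card).ne' hpow

theorem transcendental_of_one_lt_norm (k : Type*) {L : Type*} [Field k] [Finite k] [NormedField L]
    [Algebra k L] {x : L} (hx : 1 < ‖x‖) : Transcendental k x := by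
  intro halg
  have := IntermediateField.adjoin.finiteDimensional halg.isIntegral
  have : Finite (IntermediateField.adjoin k {x}) := Module.finite_of_finite k
  exact hx.not_ge (norm_le_one (algebraMap (IntermediateField.adjoin k {x}) L)
    ⟨x, IntermediateField.mem_adjoin_simple_self k x⟩)

variable {𝔽 L : Type*} [Field 𝔽] [Fintype 𝔽] [Field L] [Algebra 𝔽 L] {ζ : L}

theorem pow_card_pow_gen_ne [Finite (IntermediateField.adjoin 𝔽 {ζ})] {i : ℕ} (hi : 0 < i)
    (hid : i < Module.finrank 𝔽 (IntermediateField.adjoin 𝔽 {ζ})) :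
    IntermediateField.AdjoinSimple.gen 𝔽 ζ ^ Fintype.card 𝔽 ^ i ≠
      IntermediateField.AdjoinSimple.gen 𝔽 ζ := by
  intro h
  have : frobeniusAlgHom 𝔽 (IntermediateField.adjoin 𝔽 {ζ}) ^ i = 1 := by
    refine IntermediateField.algHom_ext_of_eq_adjoin _ rfl ?_
    rintro _ rfl
    simpa [AlgHom.coe_pow, coe_frobeniusAlgHom, pow_iterate] using congrArg Subtype.val h
  have hdvd := orderOf_dvd_of_pow_eq_one this
  rw [orderOf_frobeniusAlgHom] at hdvd
  exact (Nat.le_of_dvd hi hdvd).not_gt hid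

end FiniteField

section AndersonThakur

variable {L : Type*} [NormedField L] [IsAlgClosed L] {p q κ : ℕ} {θ lamθ : L} {w : ℕ → L}
  {Ω : ℕ → L → L}

theorem isCarlitzTaylorSystem_hyperderivative (hna : IsNonarchimedean (fun x : L => ‖x‖))
    (hp : p.Prime) [CharP L p] (hq : q = p ^ κ) (hθ : 1 < ‖θ‖)
    (hlamθ : lamθ ^ (q - 1) = -θ) (hq1 : 1 < q)
    (hωdef : ∀ z : L, ‖z‖ ≤ 1 → ∃ P : L,
      HasProd (fun j : ℕ => (1 - z / θ ^ q ^ j)⁻¹) P ∧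
      HasSum (fun i : ℕ => w i * z ^ i) (lamθ * P))
    (hΩ : ∀ (n : ℕ) (z : L), ‖z‖ ≤ 1 →
      HasSum (fun i : ℕ => ((i + n).choose n : L) * w (i + n) * z ^ i) (Ω n z))
    {k : Type*} [Field k] [Algebra k L] {d : ℕ} {z : k} (hz : z ^ q ^ d = z)
    (hz1 : ‖algebraMap k L z‖ ≤ 1) :
    IsCarlitzTaylorSystem q d z θ (fun m i => Ω m (algebraMap k L z ^ q ^ i)) := by
  have : Fact p.Prime := ⟨hp⟩
  have hnorm : ∀ i, ‖algebraMap k L z ^ q ^ i‖ ≤ 1 := fun i => by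
    rw [norm_pow]
    exact pow_le_one₀ (norm_nonneg _) hz1
  have hpow : ∀ i, (algebraMap k L z ^ q ^ i) ^ q = algebraMap k L z ^ q ^ (i + 1) := fun i => by
    rw [← pow_mul, ← pow_succ]
  have hΩ0 : ∀ x : L, ‖x‖ ≤ 1 → HasSum (fun i : ℕ => w i * x ^ i) (Ω 0 x) := fun x hx =>
    (hΩ 0 x hx).of_eq (fun i => by simp) rfl
  obtain ⟨hw0, hw⟩ := andersonThakur_coeff_pow hna hp hq hθ hlamθ hωdef
  refine ⟨⟨iterateFrobenius L p κ, fun x => by rw [iterateFrobenius_def, hq]⟩, ?_, ?_, ?_, ?_⟩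
  · obtain ⟨P, hP, hsum⟩ := hωdef _ (hnorm 0)
    rw [(hΩ0 _ (hnorm 0)).unique hsum]
    refine mul_ne_zero (fun h => ?_) (andersonThakur_product_ne_zero hna hθ hq1.pos (hnorm 0) hP)
    rw [h, zero_pow (Nat.sub_ne_zero_of_lt hq1), eq_comm, neg_eq_zero] at hlamθ
    rw [hlamθ, norm_zero] at hθ
    exact hθ.not_ge zero_le_one
  · intro m i
    simp only [← map_pow, pow_add, mul_comm (q ^ i), pow_mul, hz]
  · intro i
    have := hyperderivative_pow_zero hp hq hw0 hw (hΩ0 _ (hnorm i))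
      ((hpow i).symm ▸ hΩ0 _ (hnorm (i + 1)))
    rwa [hpow] at this
  · intro m i
    have := hyperderivative_pow_succ hp hq hw m (hΩ (m + 1) _ (hnorm i))
      ((hpow i).symm ▸ hΩ (m + 1) _ (hnorm (i + 1))) ((hpow i).symm ▸ hΩ m _ (hnorm (i + 1)))
    rwa [hpow] at this

end AndersonThakur

/-- The field `K_n(ζ)`. -/
abbrev carlitzTorsionField {𝔽 L : Type*} [Field 𝔽] [Field L] [Algebra 𝔽 L] (θ ζ : L)
    (𝔠 : Polynomial 𝔽 → L → L) (𝔭 : Polynomial 𝔽) (n : ℕ) : Subfield L :=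
  Subfield.closure (Set.range (algebraMap 𝔽 L) ∪ {θ, ζ} ∪ {y : L | 𝔠 (𝔭 ^ (n + 1)) y = 0})

/-- The field `K_0(ζ)` as an extension of the constant field. -/
abbrev carlitzBaseField {𝔽 L : Type*} [Field 𝔽] [Field L] [Algebra 𝔽 L] (θ ζ : L)
    (𝔠 : Polynomial 𝔽 → L → L) (𝔭 : Polynomial 𝔽) : IntermediateField 𝔽 L :=
  IntermediateField.adjoin 𝔽 ({θ, ζ} ∪ {y : L | 𝔠 (𝔭 ^ (0 + 1)) y = 0})

theorem carlitzBaseField_toSubfield {𝔽 L : Type*} [Field 𝔽] [Field L] [Algebra 𝔽 L] (θ ζ : L)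
    (𝔠 : Polynomial 𝔽 → L → L) (𝔭 : Polynomial 𝔽) :
    (carlitzBaseField θ ζ 𝔠 𝔭).toSubfield = carlitzTorsionField θ ζ 𝔠 𝔭 0 := by
  rw [carlitzTorsionField, Set.union_assoc]
  rfl

theorem mem_carlitzBaseField {𝔽 L : Type*} [Field 𝔽] [Field L] [Algebra 𝔽 L] (θ ζ : L)
    (𝔠 : Polynomial 𝔽 → L → L) (𝔭 : Polynomial 𝔽) : θ ∈ carlitzBaseField θ ζ 𝔠 𝔭 :=
  IntermediateField.subset_adjoin _ _ (Or.inl (Or.inl rfl))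

theorem IsCarlitzAction.torsionField_toSubfield {𝔽 L : Type*} [Field 𝔽] [Field L] [Algebra 𝔽 L]
    {q : ℕ} {θ : L} {𝔠 : Polynomial 𝔽 → L → L} (h𝔠 : IsCarlitzAction q θ 𝔠) (ζ : L)
    (𝔭 : Polynomial 𝔽) (n : ℕ) :
    (torsionField (carlitzBaseField θ ζ 𝔠 𝔭) 𝔠 (𝔭 ^ (n + 1))).toSubfield =
      carlitzTorsionField θ ζ 𝔠 𝔭 n := by
  have htors : {y | 𝔠 (𝔭 ^ (0 + 1)) y = 0} ⊆ {y | 𝔠 (𝔭 ^ (n + 1)) y = 0} := by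
    intro y (hy : 𝔠 (𝔭 ^ (0 + 1)) y = 0)
    show 𝔠 (𝔭 ^ (n + 1)) y = 0
    have h0 : 𝔠 0 0 = 0 := by simpa using h𝔠.const 0 0
    rw [zero_add, pow_one] at hy
    rw [pow_succ, h𝔠.mul, hy, ← h0, ← h𝔠.mul, mul_zero]
  refine le_antisymm (Subfield.closure_le.2 (Set.union_subset ?_ ?_))
    (Subfield.closure_le.2 (Set.union_subset ?_ ?_))
  · rintro _ ⟨x, rfl⟩
    have hx := (carlitzBaseField_toSubfield θ ζ 𝔠 𝔭).le x.2
    exact Subfield.closure_mono (Set.union_subset_union_right _ htors) hx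
  · exact Set.subset_union_right.trans Subfield.subset_closure
  · refine (Set.subset_union_left.trans Subfield.subset_closure).trans
      ((carlitzBaseField_toSubfield θ ζ 𝔠 𝔭).ge.trans fun x hx => ?_)
    exact IntermediateField.algebraMap_mem _ (⟨x, hx⟩ : carlitzBaseField θ ζ 𝔠 𝔭)
  · exact IntermediateField.subset_adjoin _ _

namespace IsCarlitzPrimeSystem

variable {𝔽 k L : Type*} [Field 𝔽] [Fintype 𝔽] [Field k] [Fintype k]
  [Field L] [Algebra 𝔽 k] [Algebra k L] [Algebra 𝔽 L] [IsScalarTower 𝔽 k L]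
  {q d : ℕ} {ζ : k} {θ : L} {V : ℕ → ℕ → L} {𝔠 : Polynomial 𝔽 → L → L} {𝔭 : Polynomial 𝔽}

theorem algebraMap_mem_baseField (H : IsCarlitzPrimeSystem q d ζ θ V 𝔠 𝔭) (α : k) :
    algebraMap k L α ∈ carlitzBaseField θ (algebraMap k L ζ) 𝔠 𝔭 := by
  obtain ⟨a, rfl⟩ := H.surj α
  rw [← Polynomial.aeval_algebraMap_apply]
  refine IntermediateField.algebra_adjoin_le_adjoin 𝔽 _
    (Algebra.adjoin_mono ?_ (Polynomial.aeval_mem_adjoin_singleton 𝔽 _))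
  rintro _ rfl
  exact Or.inl (Or.inr rfl)

variable [IsAlgClosed L]

theorem zero_mem_baseField (H : IsCarlitzPrimeSystem q d ζ θ V 𝔠 𝔭) (i : ℕ) :
    V 0 i ∈ carlitzBaseField θ (algebraMap k L ζ) 𝔠 𝔭 :=
  (H.torsion_subset_iff (S := (carlitzBaseField θ (algebraMap k L ζ) 𝔠 𝔭).toSubfield)
    H.algebraMap_mem_baseField (mem_carlitzBaseField θ _ 𝔠 𝔭) 0).1
    (Set.subset_union_right.trans (IntermediateField.subset_adjoin 𝔽 _)) 0 le_rfl i

theorem mem_adjoin_of_mem_baseField (H : IsCarlitzPrimeSystem q d ζ θ V 𝔠 𝔭) {x : L}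
    (hx : x ∈ carlitzBaseField θ (algebraMap k L ζ) 𝔠 𝔭) :
    x ∈ IntermediateField.adjoin (IntermediateField.adjoin k {θ}) {V 0 0} := by
  set S := IntermediateField.adjoin (IntermediateField.adjoin k {θ}) {V 0 0}
  have hk : ∀ α, algebraMap k L α ∈ S.toSubfield := fun α =>
    S.algebraMap_mem (algebraMap k (IntermediateField.adjoin k {θ}) α)
  have hθ : θ ∈ S.toSubfield :=
    S.algebraMap_mem ⟨θ, IntermediateField.mem_adjoin_simple_self k θ⟩
  have h0 : V 0 0 ∈ S.toSubfield := IntermediateField.mem_adjoin_simple_self _ _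
  have hle : carlitzTorsionField θ (algebraMap k L ζ) 𝔠 𝔭 0 ≤ S.toSubfield := by
    refine Subfield.closure_le.2 (Set.union_subset (Set.union_subset ?_ ?_) ?_)
    · rintro _ ⟨s, rfl⟩
      rw [IsScalarTower.algebraMap_apply 𝔽 k L]
      exact hk _
    · rintro _ (rfl | rfl)
      exacts [hθ, hk ζ]
    · refine (H.torsion_subset_iff hk hθ 0).2 fun m hm i => ?_
      rw [Nat.le_zero.1 hm]
      exact H.system.zero_mem hθ (hk ζ) h0 i
  rw [← carlitzBaseField_toSubfield] at hle
  exact hle hx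

end IsCarlitzPrimeSystem

/-- A field normal basis, Proposition on normal bases.
In the Carlitz/Anderson–Thakur setting, let
`η_n := ∏_{k=1}^n ∏_{i=1}^d ω^{(k)}(ζ_i)^{q-1} ∈ K_n(ζ)` (so `η_0 = 1`).  Then the
orbit of `η_n` under the group of field automorphisms of `K_n(ζ)` fixing `K_0(ζ)`
pointwise is a basis of `K_n(ζ)` as a vector space over `K_0(ζ)`: every element of
`K_n(ζ)` is in exactly one way a `K_0(ζ)`-linear combination of the Galois
conjugates of `η_n`. -/
theorem stmt_19 {L : Type*} [NormedField L] [CompleteSpace L] [IsAlgClosed L]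
    (hna : IsNonarchimedean (fun x : L => ‖x‖))
    (p q κ : ℕ) (hp : p.Prime) (hκ : 0 < κ) (hq : q = p ^ κ)
    (𝔽 : Type*) [Field 𝔽] [Fintype 𝔽] [Algebra 𝔽 L] (hcard : Fintype.card 𝔽 = q)
    (θ : L) (hθ : ‖θ‖ = q)
    (𝔠 : Polynomial 𝔽 → L → L)
    (hc_add : ∀ a b : Polynomial 𝔽, ∀ x : L, 𝔠 (a + b) x = 𝔠 a x + 𝔠 b x)
    (hc_mul : ∀ a b : Polynomial 𝔽, ∀ x : L, 𝔠 (a * b) x = 𝔠 a (𝔠 b x))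
    (hc_C : ∀ (s : 𝔽) (x : L), 𝔠 (Polynomial.C s) x = algebraMap 𝔽 L s * x)
    (hc_X : ∀ x : L, 𝔠 Polynomial.X x = x ^ q + θ * x)
    (hc_lin : ∀ (a : Polynomial 𝔽) (x y : L), 𝔠 a (x + y) = 𝔠 a x + 𝔠 a y)
    (hc_smul : ∀ (a : Polynomial 𝔽) (s : 𝔽) (x : L),
      𝔠 a (algebraMap 𝔽 L s * x) = algebraMap 𝔽 L s * 𝔠 a x)
    (lamθ : L) (hlamθ : lamθ ^ (q - 1) = -θ)
    (w : ℕ → L) (hw0 : Filter.Tendsto (fun i => ‖w i‖) Filter.atTop (nhds 0))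
    (hωdef : ∀ z : L, ‖z‖ ≤ 1 → ∃ P : L,
      HasProd (fun j : ℕ => (1 - z / θ ^ q ^ j)⁻¹) P ∧
      HasSum (fun i : ℕ => w i * z ^ i) (lamθ * P))
    (Ω : ℕ → L → L)
    (hΩ : ∀ (n : ℕ) (z : L), ‖z‖ ≤ 1 →
      HasSum (fun i : ℕ => ((i + n).choose n : L) * w (i + n) * z ^ i) (Ω n z))
    (d : ℕ) (hd : 0 < d)
    (𝔭 : Polynomial 𝔽) (hmonic : 𝔭.Monic) (hirr : Irreducible 𝔭)
    (hdeg : 𝔭.natDegree = d)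
    (ζ : L) (hζ : Polynomial.aeval ζ 𝔭 = 0) :
    let Kn : ℕ → Subfield L := fun n => Subfield.closure
      (Set.range (algebraMap 𝔽 L) ∪ {θ, ζ} ∪ {y : L | 𝔠 (𝔭 ^ (n + 1)) y = 0})
    ∀ n : ℕ,
      let ηn : L := ∏ k ∈ Finset.Icc 1 n, ∏ i : Fin d, Ω k (ζ ^ q ^ (i : ℕ)) ^ (q - 1)
      let orbit : Set L := {y : L | ∃ σ : L → L,
        (∀ x ∈ Kn n, ∀ x' ∈ Kn n, σ (x + x') = σ x + σ x') ∧
        (∀ x ∈ Kn n, ∀ x' ∈ Kn n, σ (x * x') = σ x * σ x') ∧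
        Set.BijOn σ (Kn n) (Kn n) ∧
        (∀ x ∈ Kn 0, σ x = x) ∧
        y = σ ηn}
      ∀ x ∈ Kn n, ∃! c : L → L,
        (∀ y : L, c y ∈ Kn 0) ∧
        (∀ y : L, c y ≠ 0 → y ∈ orbit) ∧
        x = ∑ᶠ y : L, c y * y := by
  intro Kn n ηn orbit x hx
  have hq1 : 1 < q := hq ▸ Nat.one_lt_pow hκ.ne' hp.one_lt
  have hθ1 : 1 < ‖θ‖ := by
    rw [hθ]
    exact_mod_cast hq1
  have : Fact p.Prime := ⟨hp⟩
  have : CharP 𝔽 p := charP_of_card_eq_prime_pow (hcard.trans hq)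
  have : CharP L p := charP_of_injective_algebraMap (algebraMap 𝔽 L).injective p
  have hint : IsIntegral 𝔽 ζ := ⟨𝔭, hmonic, hζ⟩
  have hfd := IntermediateField.adjoin.finiteDimensional hint
  have hfin : Finite (IntermediateField.adjoin 𝔽 {ζ}) := Module.finite_of_finite 𝔽
  have hft : Fintype (IntermediateField.adjoin 𝔽 {ζ}) := Fintype.ofFinite _
  have hrank : Module.finrank 𝔽 (IntermediateField.adjoin 𝔽 {ζ}) = d := by
    rw [IntermediateField.adjoin.finrank hint,
      ← minpoly.eq_of_irreducible_of_monic hirr hζ hmonic, hdeg]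
  have hcardk : Fintype.card (IntermediateField.adjoin 𝔽 {ζ}) = q ^ d := by
    rw [Module.card_eq_pow_finrank (K := 𝔽), hcard, hrank]
  set z := IntermediateField.AdjoinSimple.gen 𝔽 ζ with hz
  have hzζ : algebraMap (IntermediateField.adjoin 𝔽 {ζ}) L z = ζ :=
    IntermediateField.AdjoinSimple.algebraMap_gen 𝔽 ζ
  have H : IsCarlitzPrimeSystem q d z θ (fun m i => Ω m (ζ ^ q ^ i)) 𝔠 𝔭 :=
    { one_lt := hq1
      pos := hd
      card_base := hcard
      card_top := hcardk
      system := by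
        have := isCarlitzTaylorSystem_hyperderivative hna hp hq hθ1 hlamθ hq1 hωdef hΩ
          (hcardk ▸ FiniteField.pow_card z) (FiniteField.norm_le_one (algebraMap _ L) z)
        rwa [hzζ] at this
      action := ⟨hc_add, hc_mul, hc_C, hc_X⟩
      monic := hmonic
      natDegree_eq := hdeg
      irreducible := hirr
      root := by
        apply (algebraMap (IntermediateField.adjoin 𝔽 {ζ}) L).injective
        rw [← Polynomial.aeval_algebraMap_apply, hzζ, hζ, map_zero]
      surj := fun α => by
        obtain ⟨a, ha⟩ := (IntermediateField.adjoin.powerBasis hint).exists_eq_aeval' α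
        exact ⟨a, ha.symm⟩
      pow_ne := fun i hi hid => by
        rw [← hcard]
        exact FiniteField.pow_card_pow_gen_ne hi (hrank ▸ hid)
      transcendental := FiniteField.transcendental_of_one_lt_norm _ hθ1 }
  have hθE := mem_carlitzBaseField θ (algebraMap (IntermediateField.adjoin 𝔽 {ζ}) L z) 𝔠 𝔭
  set E := carlitzBaseField θ (algebraMap (IntermediateField.adjoin 𝔽 {ζ}) L z) 𝔠 𝔭 with hE
  have hgal := H.finiteDimensional_and_isGalois (E := E) hθE n
  have hfdM := hgal.1
  have hgalM := hgal.2
  have hM : (torsionField E 𝔠 (𝔭 ^ (n + 1))).toSubfield = Kn n := by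
    rw [hE, H.action.torsionField_toSubfield, hzζ]
  have hK0 : E.toSubfield = Kn 0 := by
    rw [hE, hzζ, carlitzBaseField_toSubfield]
  have hηeq : ηn = ∏ m ∈ Finset.range n, ∏ i ∈ Finset.range d,
      Ω (m + 1) (ζ ^ q ^ i) ^ (q - 1) := by
    simp only [ηn]
    rw [Finset.range_eq_Ico, Finset.prod_Ico_add' (fun k => ∏ i ∈ Finset.range d,
      Ω k (ζ ^ q ^ i) ^ (q - 1)), zero_add]
    refine Finset.prod_congr rfl fun k _ => ?_
    rw [Finset.prod_range]
  have hηmem : ηn ∈ torsionField E 𝔠 (𝔭 ^ (n + 1)) := by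
    rw [hηeq]
    refine prod_mem fun m hm => prod_mem fun i _ => pow_mem ?_ _
    exact H.mem_adjoin_torsion (E := E) H.algebraMap_mem_baseField hθE
      (Nat.succ_le_of_lt (Finset.mem_range.1 hm)) i
  have hli := H.linearIndependent_conjugates (E := E) H.algebraMap_mem_baseField hθE
    H.zero_mem_baseField (fun x hx => H.mem_adjoin_of_mem_baseField hx) n ⟨ηn, hηmem⟩ hηeq
  have hmem0 : ∀ y, y ∈ Kn 0 ↔ y ∈ Set.range (algebraMap E L) := fun y => by
    rw [← hK0]
    exact ⟨fun hy => ⟨⟨y, hy⟩, rfl⟩, fun ⟨e, he⟩ => he ▸ e.2⟩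
  have horbit : ∀ y, y ∈ orbit ↔ y ∈ Set.range fun
      σ : Gal(torsionField E 𝔠 (𝔭 ^ (n + 1))/E) =>
        (σ ⟨ηn, hηmem⟩ : L) := fun y => by
    rw [IntermediateField.mem_range_conjugates_iff]
    simp only [orbit, Set.mem_ofPred_eq, ← hM, hmem0, Set.forall_mem_range]
    rfl
  simp only [horbit, hmem0]
  rw [← hM] at hx
  exact IntermediateField.existsUnique_finsum_conjugates hli hx
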